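/- For every irrational number ρ ∈ (0,1) there exists a map G̃ : ℝ² → ℝ² which is a C¹ diffeomorphism (bijective, continuously differentiable, with continuously differentiable inverse) satisfying G̃(x + v) = G̃(x) + v for all x ∈ ℝ² and v ∈ ℤ² (so that G̃ is a lift of a C¹ diffeomorphism of the torus isotopic to the identity), whose rotation set ρ(G̃) equals Λ_ρ. In particular the rotation set of this torus diffeomorphism is not a polygon. -/

import Mathlib

open Filter Topology

/-- `α_n := ⌈nρ⌉ − nρ`. -/
noncomputable def alphaSeq (ρ : ℝ) (n : ℕ) : ℝ := (⌈(n : ℝ) * ρ⌉ : ℝ) - (n : ℝ) * ρ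

/-- `ρ_{m,n} := (⌈mρ⌉, ⌈nρ⌉)/(m+n+1)`. -/
noncomputable def vecRho (ρ : ℝ) (m n : ℕ) : ℝ × ℝ :=
  ((⌈(m : ℝ) * ρ⌉ : ℝ) / ((m : ℝ) + (n : ℝ) + 1),
   (⌈(n : ℝ) * ρ⌉ : ℝ) / ((m : ℝ) + (n : ℝ) + 1))

/-- `Λ_ρ`: the closure of the convex hull of `{0} ∪ {ρ_{m,n} : α_m < ρ, α_n < ρ}`. -/
noncomputable def LambdaSet (ρ : ℝ) : Set (ℝ × ℝ) :=
  closure (convexHull ℝ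
    ({((0 : ℝ), (0 : ℝ))} ∪
      {p : ℝ × ℝ | ∃ m n : ℕ, alphaSeq ρ m < ρ ∧ alphaSeq ρ n < ρ ∧ p = vecRho ρ m n}))

/-- The Misiurewicz–Ziemian rotation set of a lift `F : ℝ² → ℝ²`. -/
def rotSet (F : ℝ × ℝ → ℝ × ℝ) : Set (ℝ × ℝ) :=
  ⋂ m : ℕ, closure (⋃ n ∈ Set.Ioi m,
    {w : ℝ × ℝ | ∃ x : ℝ × ℝ, w = ((n : ℝ))⁻¹ • (F^[n] x - x)})

/-! ### A periodic family of smooth steps -/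

/-- A degree-one `C^1` function which climbs by `1` on `[0, ℓ] + ℤ` and is constant elsewhere. -/
noncomputable def circleStep (ℓ u : ℝ) : ℝ := ⌊u⌋ + Real.smoothTransition (Int.fract u / ℓ)

/-- The derivative of `circleStep`. -/
noncomputable def circleStepDeriv (ℓ u : ℝ) : ℝ :=
  deriv Real.smoothTransition (Int.fract u / ℓ) / ℓ

lemma differentiable_smoothTransition : Differentiable ℝ Real.smoothTransition :=
  (Real.smoothTransition.contDiff (n := 1)).differentiable (by simp)

lemma continuous_deriv_smoothTransition : Continuous (deriv Real.smoothTransition) :=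
  (Real.smoothTransition.contDiff (n := 1)).continuous_deriv (by simp)

lemma deriv_smoothTransition_of_nonpos {x : ℝ} (hx : x ≤ 0) :
    deriv Real.smoothTransition x = 0 := by
  have h : Set.EqOn (deriv Real.smoothTransition) (fun _ => 0) (closure (Set.Iio 0)) := by
    apply Set.EqOn.closure _ continuous_deriv_smoothTransition continuous_const
    intro y hy
    have : Real.smoothTransition =ᶠ[𝓝 y] fun _ => 0 := by
      filter_upwards [Iio_mem_nhds hy] with z hz
      exact Real.smoothTransition.zero_of_nonpos hz.le
    simpa using this.deriv_eq
  exact h (by simpa [closure_Iio] using hx)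

lemma deriv_smoothTransition_of_one_le {x : ℝ} (hx : 1 ≤ x) :
    deriv Real.smoothTransition x = 0 := by
  have h : Set.EqOn (deriv Real.smoothTransition) (fun _ => 0) (closure (Set.Ioi 1)) := by
    apply Set.EqOn.closure _ continuous_deriv_smoothTransition continuous_const
    intro y hy
    have : Real.smoothTransition =ᶠ[𝓝 y] fun _ => 1 := by
      filter_upwards [Ioi_mem_nhds hy] with z hz
      exact Real.smoothTransition.one_of_one_le (le_of_lt hz)
    simpa using this.deriv_eq
  exact h (by simpa [closure_Ioi] using hx)

lemma exists_deriv_smoothTransition_bound :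
    ∃ K : ℝ, 1 ≤ K ∧ ∀ x, |deriv Real.smoothTransition x| ≤ K := by
  obtain ⟨K, hK⟩ := (isCompact_Icc (a := (0 : ℝ)) (b := 1)).exists_bound_of_continuousOn
    continuous_deriv_smoothTransition.continuousOn
  refine ⟨max K 1, le_max_right _ _, fun x => ?_⟩
  rcases le_or_gt x 0 with h | h
  · rw [deriv_smoothTransition_of_nonpos h]; simp
  rcases le_or_gt 1 x with h' | h'
  · rw [deriv_smoothTransition_of_one_le h']; simp
  exact (hK x ⟨h.le, h'.le⟩).trans (le_max_left _ _)

lemma circleStep_of_mem {ℓ u : ℝ} {k : ℤ} (h0 : 0 < ℓ) (h1 : k - 1 + ℓ ≤ u) (h2 : u < k + 1) :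
    circleStep ℓ u = k + Real.smoothTransition ((u - k) / ℓ) := by
  rcases le_or_gt (k : ℝ) u with h | h
  · have : ⌊u⌋ = k := Int.floor_eq_iff.2 ⟨h, h2⟩
    simp [circleStep, Int.fract, this]
  · have : ⌊u⌋ = k - 1 := Int.floor_eq_iff.2 ⟨by push_cast; linarith, by push_cast; linarith⟩
    rw [circleStep, Int.fract, this, Real.smoothTransition.one_of_one_le,
      Real.smoothTransition.zero_of_nonpos]
    · push_cast; ring
    · exact div_nonpos_of_nonpos_of_nonneg (by linarith) h0.le
    · rw [le_div_iff₀ h0]; push_cast; linarith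

lemma circleStepDeriv_of_mem {ℓ u : ℝ} {k : ℤ} (h0 : 0 < ℓ) (h1 : k - 1 + ℓ ≤ u)
    (h2 : u < k + 1) :
    circleStepDeriv ℓ u = deriv Real.smoothTransition ((u - k) / ℓ) / ℓ := by
  rcases le_or_gt (k : ℝ) u with h | h
  · have : ⌊u⌋ = k := Int.floor_eq_iff.2 ⟨h, h2⟩
    simp [circleStepDeriv, Int.fract, this]
  · have : ⌊u⌋ = k - 1 := Int.floor_eq_iff.2 ⟨by push_cast; linarith, by push_cast; linarith⟩
    rw [circleStepDeriv, Int.fract, this, deriv_smoothTransition_of_one_le,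
      deriv_smoothTransition_of_nonpos]
    · exact div_nonpos_of_nonpos_of_nonneg (by linarith) h0.le
    · rw [le_div_iff₀ h0]; push_cast; linarith

lemma circleStep_nhds {ℓ : ℝ} (h1 : ℓ < 1) (u : ℝ) :
    ∀ᶠ v in 𝓝 u, (⌊u⌋ : ℝ) - 1 + ℓ ≤ v ∧ v < ⌊u⌋ + 1 := by
  have := Int.floor_le u
  filter_upwards [Ioo_mem_nhds (show (⌊u⌋ : ℝ) - 1 + ℓ < u by linarith) (Int.lt_floor_add_one u)]
    with v hv using ⟨hv.1.le, hv.2⟩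

lemma hasDerivAt_circleStep {ℓ : ℝ} (h0 : 0 < ℓ) (h1 : ℓ < 1) (u : ℝ) :
    HasDerivAt (circleStep ℓ) (circleStepDeriv ℓ u) u := by
  have h : circleStep ℓ =ᶠ[𝓝 u] fun v => ⌊u⌋ + Real.smoothTransition ((v - ⌊u⌋) / ℓ) := by
    filter_upwards [circleStep_nhds h1 u] with v hv using circleStep_of_mem h0 hv.1 hv.2
  refine HasDerivAt.congr_of_eventuallyEq ?_ h
  have h2 : HasDerivAt (fun v : ℝ => (v - ⌊u⌋) / ℓ) (1 / ℓ) u :=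
    ((hasDerivAt_id u).sub_const _).div_const ℓ
  have h3 := ((differentiable_smoothTransition ((u - ⌊u⌋) / ℓ)).hasDerivAt.comp u h2).const_add
    (⌊u⌋ : ℝ)
  exact h3.congr_deriv (by simp only [circleStepDeriv, Int.fract]; ring)

lemma continuous_circleStepDeriv {ℓ : ℝ} (h0 : 0 < ℓ) (h1 : ℓ < 1) :
    Continuous (circleStepDeriv ℓ) := by
  rw [continuous_iff_continuousAt]
  intro u
  have h : circleStepDeriv ℓ =ᶠ[𝓝 u]
      fun v => deriv Real.smoothTransition ((v - ⌊u⌋) / ℓ) / ℓ := by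
    filter_upwards [circleStep_nhds h1 u] with v hv using circleStepDeriv_of_mem h0 hv.1 hv.2
  refine ContinuousAt.congr ?_ h.symm
  exact ((continuous_deriv_smoothTransition.comp (by fun_prop)).div_const _).continuousAt

lemma contDiff_circleStep {ℓ : ℝ} (h0 : 0 < ℓ) (h1 : ℓ < 1) : ContDiff ℝ 1 (circleStep ℓ) := by
  rw [contDiff_one_iff_deriv]
  refine ⟨fun u => (hasDerivAt_circleStep h0 h1 u).differentiableAt, ?_⟩
  rw [show deriv (circleStep ℓ) = circleStepDeriv ℓ from
    funext fun u => (hasDerivAt_circleStep h0 h1 u).deriv]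
  exact continuous_circleStepDeriv h0 h1

lemma circleStep_add_one (ℓ u : ℝ) : circleStep ℓ (u + 1) = circleStep ℓ u + 1 := by
  simp [circleStep]; ring

lemma circleStep_eq_of_mem {ℓ u : ℝ} {k : ℤ} (h0 : 0 < ℓ) (h1 : k - 1 + ℓ ≤ u) (h2 : u ≤ k) :
    circleStep ℓ u = k := by
  rw [circleStep_of_mem h0 h1 (by linarith), Real.smoothTransition.zero_of_nonpos, add_zero]
  exact div_nonpos_of_nonpos_of_nonneg (by linarith) h0.le

lemma abs_circleStep_sub_le (ℓ u : ℝ) : |circleStep ℓ u - u| ≤ 1 := by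
  have h1 := Real.smoothTransition.nonneg (Int.fract u / ℓ)
  have h2 := Real.smoothTransition.le_one (Int.fract u / ℓ)
  have h3 := Int.floor_le u
  have h4 := Int.lt_floor_add_one u
  rw [circleStep, abs_le]
  constructor <;> linarith

lemma exists_mem_of_circleStepDeriv_ne_zero {ℓ u : ℝ} (h0 : 0 < ℓ)
    (h : circleStepDeriv ℓ u ≠ 0) : 0 < Int.fract u ∧ Int.fract u < ℓ := by
  constructor
  · by_contra! h'
    exact h (by rw [circleStepDeriv, deriv_smoothTransition_of_nonpos, zero_div]
                exact div_nonpos_of_nonpos_of_nonneg h' h0.le)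
  · by_contra! h'
    exact h (by rw [circleStepDeriv, deriv_smoothTransition_of_one_le, zero_div]
                rwa [le_div_iff₀ h0, one_mul])

/-! ### Bump functions on the circle -/

lemma exists_circle_bump {ℓ : ℝ} (h0 : 0 < ℓ) (h1 : ℓ < 1) :
    ∃ b : ℝ → ℝ, ∃ Z : ℝ, ContDiff ℝ 1 b ∧ (∀ x, b (x + 1) = b x) ∧ (∀ x, 0 ≤ b x) ∧
      (∀ x, b x ≤ 1) ∧ b 0 = 0 ∧ 0 < Z ∧ Z < ℓ ∧ b Z = 1 ∧
      ∀ x, b x ≠ 0 → ∃ k : ℤ, 0 ≤ x - k ∧ x - k ≤ ℓ := by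
  have hz : circleStep ℓ 0 = 0 := by
    simpa using circleStep_eq_of_mem (k := 0) (u := 0) h0 (by push_cast; linarith) (by simp)
  have hl : circleStep ℓ ℓ = 1 := by
    simpa using circleStep_eq_of_mem (k := 1) (u := ℓ) h0 (by push_cast; linarith)
      (by push_cast; linarith)
  obtain ⟨Z, hZ, hZ'⟩ := intermediate_value_Icc h0.le
    (contDiff_circleStep h0 h1).continuous.continuousOn
    (show (1 / 2 : ℝ) ∈ Set.Icc (circleStep ℓ 0) (circleStep ℓ ℓ) by
      rw [hz, hl]; constructor <;> norm_num)
  refine ⟨fun x => Real.sin (Real.pi * circleStep ℓ x) ^ 2, Z, ?_, ?_, fun x => sq_nonneg _,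
    fun x => Real.sin_sq_le_one _, ?_, ?_, ?_, ?_, ?_⟩
  · exact (Real.contDiff_sin.comp (contDiff_const.mul (contDiff_circleStep h0 h1))).pow 2
  · intro x
    simp only [circleStep_add_one, mul_add, mul_one, Real.sin_add_pi]
    ring
  · simp [hz]
  · refine lt_of_le_of_ne hZ.1 ?_
    rintro rfl
    rw [hz] at hZ'; norm_num at hZ'
  · refine lt_of_le_of_ne hZ.2 ?_
    rintro rfl
    rw [hl] at hZ'; norm_num at hZ'
  · simp only [hZ']
    rw [show Real.pi * (1 / 2) = Real.pi / 2 by ring]; simp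
  · intro x hx
    refine ⟨⌊x⌋, by linarith [Int.floor_le x], ?_⟩
    by_contra! h
    apply hx
    have : circleStep ℓ x = (⌊x⌋ + 1 : ℤ) :=
      circleStep_eq_of_mem h0 (by push_cast; linarith) (by push_cast; linarith [Int.lt_floor_add_one x])
    simp only [this]
    rw [mul_comm, Real.sin_int_mul_pi]; simp

/-! ### Denjoy's `C^1` circle diffeomorphism -/

lemma exists_denjoy_weights {K : ℝ} (hK : 1 ≤ K) :
    ∃ w : ℤ → ℝ, (∀ n, 0 < w n) ∧ HasSum w 1 ∧
      (∀ n, |w (n + 1) / w n - 1| * K ≤ 1 / 2) ∧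
      Tendsto (fun n => w (n + 1) / w n - 1) cofinite (𝓝 0) := by
  set A : ℝ := 6 * K with hA
  have hA6 : 6 ≤ A := by linarith
  set v : ℤ → ℝ := fun n => 1 / (A + |(n : ℝ)|) ^ 2 with hv
  have hpos : ∀ n : ℤ, 0 < A + |(n : ℝ)| := fun n => by positivity
  have hvpos : ∀ n, 0 < v n := fun n => by have := hpos n; positivity
  have hnat : Summable fun n : ℕ => 1 / (A + (n : ℝ)) ^ 2 := by
    have h := (summable_nat_add_iff 1).2 (Real.summable_one_div_nat_pow.2 one_lt_two)
    refine Summable.of_nonneg_of_le (fun n => by positivity) (fun n => ?_) h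
    push_cast
    gcongr ?_ / ?_ ^ 2
    all_goals linarith
  have hsum : Summable v := by
    apply Summable.of_nat_of_neg
    · simpa [hv] using hnat
    · simpa [hv] using hnat
  set S := ∑' n, v n with hS
  have hSpos : 0 < S := hsum.tsum_pos (fun n => (hvpos n).le) 0 (hvpos 0)
  have hratio : ∀ n : ℤ, v (n + 1) / S / (v n / S) - 1 = v (n + 1) / v n - 1 := fun n => by
    have := hvpos n
    field_simp
  have hbd : ∀ n : ℤ, |v (n + 1) / v n - 1| ≤ 3 / (A + |((n + 1 : ℤ) : ℝ)|) := by
    intro n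
    have h1 := hpos n
    have h2 := hpos (n + 1)
    have habs : |(|((n : ℤ) : ℝ)| - |((n + 1 : ℤ) : ℝ)|)| ≤ 1 := by
      refine (abs_abs_sub_abs_le _ _).trans ?_
      push_cast
      rw [show (n : ℝ) - (n + 1) = -1 by ring]; simp
    set s := A + |(n : ℝ)| with hs
    set s' := A + |((n + 1 : ℤ) : ℝ)| with hs'
    have hss : |s - s'| ≤ 1 := by rw [hs, hs']; simpa using habs
    have hs'6 : 6 ≤ s' := by rw [hs']; linarith [abs_nonneg ((n + 1 : ℤ) : ℝ)]
    have : v (n + 1) / v n - 1 = (s - s') * (s + s') / s' ^ 2 := by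
      simp only [hv]; rw [← hs, ← hs']; field_simp; ring
    rw [this, abs_div, abs_mul, abs_of_pos (show 0 < s + s' by linarith),
      abs_of_pos (show 0 < s' ^ 2 by positivity), div_le_div_iff₀ (by positivity) h2]
    have h3 : s ≤ s' + 1 := by linarith [(abs_le.1 hss).2]
    have h4 : |s - s'| * (s + s') ≤ 1 * (2 * s' + 1) :=
      mul_le_mul hss (by linarith) (by linarith) zero_le_one
    nlinarith
  refine ⟨fun n => v n / S, fun n => div_pos (hvpos n) hSpos, ?_, ?_, ?_⟩
  · have h := hsum.hasSum.div_const S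
    rwa [← hS, div_self hSpos.ne'] at h
  · intro n
    rw [hratio]
    have h1 : 3 / (A + |((n + 1 : ℤ) : ℝ)|) ≤ 3 / A := by
      gcongr
      linarith [abs_nonneg ((n + 1 : ℤ) : ℝ)]
    calc _ ≤ 3 / A * K := by gcongr; exact (hbd n).trans h1
      _ = 1 / 2 := by rw [hA]; field_simp; norm_num
  · simp only [hratio]
    refine squeeze_zero_norm hbd ?_
    have h1 : Tendsto (fun n : ℤ => A + |((n + 1 : ℤ) : ℝ)|) cofinite atTop := by
      apply tendsto_atTop_add_const_left
      have h2 : Tendsto (fun n : ℤ => ‖((n : ℤ) : ℝ)‖) cofinite atTop :=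
        tendsto_norm_cocompact_atTop.comp Int.tendsto_coe_cofinite
      exact h2.comp (add_left_injective (1 : ℤ)).tendsto_cofinite
    exact h1.const_div_atTop 3

/-- The least point of `nρ + ℤ` which is at least `t`. -/
noncomputable def orbitCeil (ρ : ℝ) (n : ℤ) (t : ℝ) : ℝ := ⌈t - n * ρ⌉ + n * ρ

lemma le_orbitCeil (ρ : ℝ) (n : ℤ) (t : ℝ) : t ≤ orbitCeil ρ n t := by
  have := Int.le_ceil (t - n * ρ)
  rw [orbitCeil]; linarith

lemma orbitCeil_lt (ρ : ℝ) (n : ℤ) (t : ℝ) : orbitCeil ρ n t < t + 1 := by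
  have := Int.ceil_lt_add_one (t - n * ρ)
  rw [orbitCeil]; linarith

lemma orbitCeil_mono (ρ : ℝ) (n : ℤ) : Monotone (orbitCeil ρ n) := by
  intro s t h
  unfold orbitCeil
  gcongr

lemma orbitCeil_add_one (ρ : ℝ) (n : ℤ) (t : ℝ) : orbitCeil ρ n (t + 1) = orbitCeil ρ n t + 1 := by
  rw [orbitCeil, orbitCeil, show t + 1 - n * ρ = (t - n * ρ) + 1 by ring, Int.ceil_add_one]
  push_cast; ring

lemma orbitCeil_add_rot (ρ : ℝ) (n : ℤ) (t : ℝ) :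
    orbitCeil ρ (n + 1) (t + ρ) = orbitCeil ρ n t + ρ := by
  rw [orbitCeil, orbitCeil]
  push_cast
  rw [show t + ρ - (n + 1) * ρ = t - n * ρ by ring]; ring

lemma orbitCeil_self (ρ : ℝ) (n k : ℤ) : orbitCeil ρ n (n * ρ + k) = n * ρ + k := by
  rw [orbitCeil, add_sub_cancel_left, Int.ceil_intCast, add_comm]

lemma orbitCeil_add_one_le (ρ : ℝ) (n k : ℤ) {t : ℝ} (h : n * ρ + k < t) :
    n * ρ + k + 1 ≤ orbitCeil ρ n t := by
  have : k < ⌈t - n * ρ⌉ := Int.lt_ceil.2 (by linarith)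
  have : (k : ℝ) + 1 ≤ ⌈t - n * ρ⌉ := by exact_mod_cast this
  rw [orbitCeil]; linarith

/-- The distribution function of the measure with atoms of mass `w n` on `nρ + ℤ`. -/
noncomputable def gapPosition (ρ : ℝ) (w : ℤ → ℝ) (t : ℝ) : ℝ := ∑' n, w n * orbitCeil ρ n t

/-- Denjoy's map: a `C^1` homeomorphism of the line sending the gap based at `nρ` to the gap
based at `(n + 1)ρ`. -/
noncomputable def denjoyMap (ρ : ℝ) (w : ℤ → ℝ) (x : ℝ) : ℝ :=
  x + ρ + ∑' n : ℤ, (w (n + 1) - w n) *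
    (n * ρ + circleStep (w n) (x - gapPosition ρ w (n * ρ)))

section Denjoy

variable {ρ : ℝ} {w : ℤ → ℝ}

lemma summable_gapPosition (hw : ∀ n, 0 < w n) (hs : HasSum w 1) (t : ℝ) :
    Summable fun n => w n * orbitCeil ρ n t := by
  refine Summable.of_norm_bounded (hs.summable.mul_right (|t| + 1)) fun n => ?_
  rw [norm_mul, Real.norm_of_nonneg (hw n).le, Real.norm_eq_abs]
  refine mul_le_mul_of_nonneg_left ?_ (hw n).le
  have h1 := le_orbitCeil ρ n t
  have h2 := orbitCeil_lt ρ n t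
  rw [abs_le]
  constructor <;> linarith [neg_abs_le t, le_abs_self t]

lemma le_gapPosition (hw : ∀ n, 0 < w n) (hs : HasSum w 1) (t : ℝ) : t ≤ gapPosition ρ w t := by
  have h := hs.mul_right t
  rw [one_mul] at h
  exact hasSum_le (fun n => mul_le_mul_of_nonneg_left (le_orbitCeil ρ n t) (hw n).le) h
    (summable_gapPosition hw hs t).hasSum

lemma gapPosition_le (hw : ∀ n, 0 < w n) (hs : HasSum w 1) (t : ℝ) :
    gapPosition ρ w t ≤ t + 1 := by
  have h := hs.mul_right (t + 1)
  rw [one_mul] at h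
  exact hasSum_le (fun n => mul_le_mul_of_nonneg_left (orbitCeil_lt ρ n t).le (hw n).le)
    (summable_gapPosition hw hs t).hasSum h

lemma gapPosition_mono (hw : ∀ n, 0 < w n) (hs : HasSum w 1) : Monotone (gapPosition ρ w) :=
  fun s t h => (summable_gapPosition hw hs s).tsum_le_tsum
    (fun n => mul_le_mul_of_nonneg_left (orbitCeil_mono ρ n h) (hw n).le)
    (summable_gapPosition hw hs t)

lemma gapPosition_add_one (hw : ∀ n, 0 < w n) (hs : HasSum w 1) (t : ℝ) :
    gapPosition ρ w (t + 1) = gapPosition ρ w t + 1 := by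
  rw [gapPosition, gapPosition]
  simp only [orbitCeil_add_one, mul_add, mul_one]
  rw [(summable_gapPosition hw hs t).tsum_add hs.summable, hs.tsum_eq]

lemma gapPosition_add_intCast (hw : ∀ n, 0 < w n) (hs : HasSum w 1) (t : ℝ) (k : ℤ) :
    gapPosition ρ w (t + k) = gapPosition ρ w t + k := by
  induction k using Int.induction_on with
  | zero => simp
  | succ i ih => push_cast at ih ⊢; rw [← add_assoc, gapPosition_add_one hw hs, ih, add_assoc]
  | pred i ih =>
    have := gapPosition_add_one (ρ := ρ) hw hs (t + (-(i : ℝ) - 1))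
    rw [show t + (-(i : ℝ) - 1) + 1 = t + -(i : ℝ) by ring] at this
    push_cast at ih ⊢
    linarith

lemma gapPosition_jump (hw : ∀ n, 0 < w n) (hs : HasSum w 1) (n k : ℤ) {t : ℝ}
    (h : n * ρ + k < t) :
    gapPosition ρ w (n * ρ + k) + w n ≤ gapPosition ρ w t := by
  have h1 : HasSum (fun m => if m = n then w n else 0) (w n) := hasSum_ite_eq n (w n)
  have h2 := summable_gapPosition (ρ := ρ) hw hs (n * ρ + k)
  rw [gapPosition, ← h1.tsum_eq, ← h2.tsum_add h1.summable]
  refine (h2.add h1.summable).tsum_le_tsum (fun m => ?_) (summable_gapPosition hw hs t)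
  split_ifs with hm
  · subst hm
    rw [orbitCeil_self, ← mul_add_one]
    exact mul_le_mul_of_nonneg_left (orbitCeil_add_one_le ρ m k h) (hw m).le
  · rw [add_zero]
    exact mul_le_mul_of_nonneg_left (orbitCeil_mono ρ m h.le) (hw m).le

lemma weight_lt_one (hw : ∀ n, 0 < w n) (hs : HasSum w 1) (n : ℤ) : w n < 1 := by
  have h := hs.summable.sum_le_tsum {n, n + 1} (fun i _ => (hw i).le)
  rw [Finset.sum_pair (by simp), hs.tsum_eq] at h
  linarith [hw (n + 1)]

/-- On the image of `gapPosition`, the steps recover `orbitCeil`. -/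
lemma step_gapPosition (hw : ∀ n, 0 < w n) (hs : HasSum w 1) (n : ℤ) (t : ℝ) :
    n * ρ + circleStep (w n) (gapPosition ρ w t - gapPosition ρ w (n * ρ)) = orbitCeil ρ n t := by
  set k := ⌈t - n * ρ⌉ with hk
  have h1 : t ≤ n * ρ + k := by linarith [Int.le_ceil (t - n * ρ)]
  have h2 : n * ρ + (k - 1 : ℤ) < t := by
    push_cast; linarith [Int.ceil_lt_add_one (t - n * ρ)]
  have h3 := gapPosition_mono (ρ := ρ) hw hs h1
  have h4 := gapPosition_jump hw hs n (k - 1) h2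
  rw [gapPosition_add_intCast hw hs] at h3 h4
  push_cast at h4
  rw [circleStep_eq_of_mem (k := k) (hw n) (by linarith) (by linarith), orbitCeil, add_comm]

lemma summable_shift_sub (hs : HasSum w 1) : HasSum (fun n => w (n + 1) - w n) 0 := by
  have h : HasSum (fun n => w (n + 1)) 1 := (Equiv.addRight (1 : ℤ)).hasSum_iff.2 hs
  simpa using h.sub hs

lemma summable_denjoyMap (hw : ∀ n, 0 < w n) (hs : HasSum w 1) (x : ℝ) :
    Summable fun n : ℤ => (w (n + 1) - w n) *
      (n * ρ + circleStep (w n) (x - gapPosition ρ w (n * ρ))) := by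
  have h : HasSum (fun n => w (n + 1)) 1 := (Equiv.addRight (1 : ℤ)).hasSum_iff.2 hs
  refine Summable.of_norm_bounded ((h.add hs).summable.mul_right (|x| + 2)) fun n => ?_
  rw [norm_mul, Real.norm_eq_abs, Real.norm_eq_abs]
  have h1 : |w (n + 1) - w n| ≤ w (n + 1) + w n := by
    rw [abs_le]; constructor <;> linarith [hw n, hw (n + 1)]
  refine mul_le_mul h1 ?_ (abs_nonneg _) (by linarith [hw n, hw (n + 1)])
  have h2 := abs_le.1 (abs_circleStep_sub_le (w n) (x - gapPosition ρ w (n * ρ)))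
  have h3 := le_gapPosition (ρ := ρ) hw hs (n * ρ)
  have h4 := gapPosition_le (ρ := ρ) hw hs (n * ρ)
  rw [abs_le]
  constructor <;> linarith [neg_abs_le x, le_abs_self x]

lemma denjoyMap_gapPosition (hw : ∀ n, 0 < w n) (hs : HasSum w 1) (t : ℝ) :
    denjoyMap ρ w (gapPosition ρ w t) = gapPosition ρ w (t + ρ) := by
  have h : HasSum (fun n => w (n + 1)) 1 := (Equiv.addRight (1 : ℤ)).hasSum_iff.2 hs
  have h1 := summable_gapPosition (ρ := ρ) hw hs t
  have h2 : Summable fun n : ℤ => (w (n + 1) - w n) * orbitCeil ρ n t := by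
    simpa only [step_gapPosition hw hs] using summable_denjoyMap (ρ := ρ) hw hs (gapPosition ρ w t)
  have h3 : gapPosition ρ w (t + ρ) = ∑' n : ℤ, w (n + 1) * (orbitCeil ρ n t + ρ) := by
    rw [gapPosition, ← (Equiv.addRight (1 : ℤ)).tsum_eq]
    simp only [Equiv.coe_addRight, orbitCeil_add_rot]
  have h4 : HasSum (fun n => w (n + 1) * ρ) ρ := by simpa using h.mul_right ρ
  rw [denjoyMap, h3]
  simp only [step_gapPosition hw hs]
  conv_lhs => enter [1, 1]; rw [gapPosition]
  rw [add_right_comm, ← h1.tsum_add h2]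
  conv_lhs => enter [2]; rw [← h4.tsum_eq]
  rw [← (h1.add h2).tsum_add h4.summable]
  congr 1; ext n; ring

lemma denjoyMap_add_one (hw : ∀ n, 0 < w n) (hs : HasSum w 1) (x : ℝ) :
    denjoyMap ρ w (x + 1) = denjoyMap ρ w x + 1 := by
  have h := summable_denjoyMap (ρ := ρ) hw hs x
  have h' := summable_shift_sub hs
  rw [denjoyMap, denjoyMap]
  simp only [add_sub_right_comm x 1, circleStep_add_one]
  simp only [← add_assoc, mul_add _ _ (1 : ℝ), mul_one]
  rw [h.tsum_add h'.summable, h'.tsum_eq]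
  ring

lemma eq_of_gap_mem (hirr : Irrational ρ) (hw : ∀ n, 0 < w n) (hs : HasSum w 1) {x : ℝ} {m n : ℤ}
    (hm : circleStepDeriv (w m) (x - gapPosition ρ w (m * ρ)) ≠ 0)
    (hn : circleStepDeriv (w n) (x - gapPosition ρ w (n * ρ)) ≠ 0) : m = n := by
  obtain ⟨hm1, hm2⟩ := exists_mem_of_circleStepDeriv_ne_zero (hw m) hm
  obtain ⟨hn1, hn2⟩ := exists_mem_of_circleStepDeriv_ne_zero (hw n) hn
  set i := ⌊x - gapPosition ρ w (m * ρ)⌋ with hi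
  set j := ⌊x - gapPosition ρ w (n * ρ)⌋ with hj
  rw [Int.fract, ← hi] at hm1 hm2
  rw [Int.fract, ← hj] at hn1 hn2
  rcases lt_trichotomy (m * ρ + i) (n * ρ + j) with h | h | h
  · have := gapPosition_jump hw hs m i h
    rw [gapPosition_add_intCast hw hs, gapPosition_add_intCast hw hs] at this
    linarith
  · by_contra hne
    have h1 : Irrational (((m - n : ℤ) : ℝ) * ρ) := hirr.intCast_mul (sub_ne_zero.2 hne)
    exact h1.ne_int (j - i) (by push_cast; linarith)
  · have := gapPosition_jump hw hs n j h
    rw [gapPosition_add_intCast hw hs, gapPosition_add_intCast hw hs] at this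
    linarith

end Denjoy

lemma exists_denjoyMap_deriv {ρ : ℝ} (hirr : Irrational ρ) {w : ℤ → ℝ} {K : ℝ}
    (hK : ∀ x, |deriv Real.smoothTransition x| ≤ K)
    (hw : ∀ n, 0 < w n) (hs : HasSum w 1) (hb : ∀ n, |w (n + 1) / w n - 1| * K ≤ 1 / 2)
    (ht : Tendsto (fun n => w (n + 1) / w n - 1) cofinite (𝓝 0)) :
    ∃ f' : ℝ → ℝ, Continuous f' ∧ (∀ x, HasDerivAt (denjoyMap ρ w) (f' x) x) ∧ ∀ x, 0 < f' x := by
  set g : ℤ → ℝ → ℝ := fun n x =>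
    (w (n + 1) - w n) * circleStepDeriv (w n) (x - gapPosition ρ w (n * ρ)) with hg
  have hgb : ∀ n x, |g n x| ≤ |w (n + 1) / w n - 1| * K := by
    intro n x
    have := hw n
    have h1 : g n x = (w (n + 1) / w n - 1) * deriv Real.smoothTransition
        (Int.fract (x - gapPosition ρ w (n * ρ)) / w n) := by
      simp only [hg, circleStepDeriv]; field_simp
    rw [h1, abs_mul]
    exact mul_le_mul_of_nonneg_left (hK _) (abs_nonneg _)
  have huniq : ∀ x m n, g m x ≠ 0 → g n x ≠ 0 → m = n := fun x m n hm hn =>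
    eq_of_gap_mem hirr hw hs (right_ne_zero_of_mul hm) (right_ne_zero_of_mul hn)
  have hcases : ∀ x, (∀ n, g n x = 0) ∨ ∃ n, ∀ m, m ≠ n → g m x = 0 := by
    intro x
    by_cases h : ∀ n, g n x = 0
    · exact Or.inl h
    · push Not at h
      obtain ⟨n, hn⟩ := h
      refine Or.inr ⟨n, fun m hm => ?_⟩
      by_contra h'
      exact hm (huniq x m n h' hn)
  have htK : Tendsto (fun n => |w (n + 1) / w n - 1| * K) cofinite (𝓝 0) := by
    simpa using ht.abs.mul_const K
  have hunif : TendstoUniformly (fun (s : Finset ℤ) x => ∑ n ∈ s, g n x)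
      (fun x => ∑' n, g n x) atTop := by
    rw [Metric.tendstoUniformly_iff]
    intro ε hε
    have h1 : {n : ℤ | ¬ |w (n + 1) / w n - 1| * K < ε}.Finite :=
      htK.eventually (gt_mem_nhds hε)
    filter_upwards [eventually_ge_atTop h1.toFinset] with s hs' x
    rcases hcases x with h | ⟨n, hn⟩
    · simpa [h] using hε
    · rw [tsum_eq_single n hn]
      by_cases hns : n ∈ s
      · rw [Finset.sum_eq_single_of_mem n hns (fun m _ hm => hn m hm)]
        simpa using hε
      · rw [Finset.sum_eq_zero (fun m hm => hn m (fun h => hns (h ▸ hm)))]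
        have h2 : n ∉ h1.toFinset := fun h => hns (hs' h)
        simp only [Set.Finite.mem_toFinset, Set.mem_ofPred_eq, not_not] at h2
        rw [Real.dist_eq, sub_zero]
        exact (hgb n x).trans_lt h2
  have hcont : Continuous fun x => ∑' n, g n x := by
    refine hunif.continuous (Frequently.of_forall fun s => ?_)
    refine continuous_finsetSum s fun n _ => continuous_const.mul ?_
    exact (continuous_circleStepDeriv (hw n) (weight_lt_one hw hs n)).comp (by fun_prop)
  have hderiv : ∀ x, HasDerivAt (fun x => ∑' n : ℤ, (w (n + 1) - w n) *
      (n * ρ + circleStep (w n) (x - gapPosition ρ w (n * ρ)))) (∑' n, g n x) x := by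
    refine hasDerivAt_of_tendstoUniformly hunif (f := fun s x => ∑ n ∈ s, (w (n + 1) - w n) *
      (n * ρ + circleStep (w n) (x - gapPosition ρ w (n * ρ)))) ?_ ?_
    · refine Eventually.of_forall fun s x => HasDerivAt.fun_sum fun n _ => ?_
      have h1 := (hasDerivAt_circleStep (hw n) (weight_lt_one hw hs n)
        (x - gapPosition ρ w (n * ρ))).comp x ((hasDerivAt_id x).sub_const _)
      rw [mul_one] at h1
      exact (h1.const_add (n * ρ)).const_mul _
    · exact fun x => (summable_denjoyMap hw hs x).hasSum
  refine ⟨fun x => 1 + ∑' n, g n x, continuous_const.add hcont, fun x => ?_, fun x => ?_⟩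
  · exact ((hasDerivAt_id x).add_const ρ).add (hderiv x)
  · rcases hcases x with h | ⟨n, hn⟩
    · simp [h]
    · simp only
      rw [tsum_eq_single n hn]
      linarith [(abs_le.1 ((hgb n x).trans (hb n))).1]

/-- A Denjoy map `f` with rotation number `ρ`, a semi-conjugacy `p` to the rotation, and a
wandering interval `[0, ℓ]`. -/
structure IsDenjoy (ρ : ℝ) (f p : ℝ → ℝ) (ℓ : ℝ) : Prop where
  pos : 0 < ℓ
  lt_one : ℓ < 1
  contDiff : ContDiff ℝ 1 f
  deriv_pos : ∀ x, 0 < deriv f x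
  map_add_one : ∀ x, f (x + 1) = f x + 1
  mono : Monotone p
  semi_add_one : ∀ x, p (x + 1) = p x + 1
  semi_map : ∀ x, p (f x) = p x + ρ
  semi_gap : ∀ x, 0 ≤ x → x ≤ ℓ → p x = 0

lemma sSup_eq_add_of_translate {A B : Set ℝ} {c : ℝ} (h : ∀ t, t ∈ A ↔ t - c ∈ B)
    (hne : B.Nonempty) (hbd : BddAbove B) : sSup A = sSup B + c := by
  have h1 : A = OrderIso.addRight c '' B := by
    ext t
    rw [h, OrderIso.image_eq_preimage_symm]
    simp [sub_eq_add_neg]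
  rw [h1, ← OrderIso.map_csSup' _ hne hbd]
  rfl

theorem exists_isDenjoy {ρ : ℝ} (hirr : Irrational ρ) :
    ∃ f p : ℝ → ℝ, ∃ ℓ : ℝ, IsDenjoy ρ f p ℓ := by
  obtain ⟨K, hK1, hK⟩ := exists_deriv_smoothTransition_bound
  obtain ⟨w, hw, hs, hb, ht⟩ := exists_denjoy_weights hK1
  obtain ⟨f', hf'c, hf', hf'pos⟩ := exists_denjoyMap_deriv (ρ := ρ) hirr hK hw hs hb ht
  have hd : deriv (denjoyMap ρ w) = f' := funext fun x => (hf' x).deriv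
  have hC : ContDiff ℝ 1 (denjoyMap ρ w) :=
    contDiff_one_iff_deriv.2 ⟨fun x => (hf' x).differentiableAt, hd ▸ hf'c⟩
  have hmono : StrictMono (denjoyMap ρ w) :=
    strictMono_of_deriv_pos fun x => by rw [hd]; exact hf'pos x
  set q := gapPosition ρ w with hq
  set P : ℝ → ℝ := fun x => sSup {t | q t ≤ x} with hP
  have hne : ∀ x, {t | q t ≤ x}.Nonempty := fun x =>
    ⟨x - 1, (gapPosition_le hw hs (x - 1)).trans (by linarith)⟩
  have hbd : ∀ x, BddAbove {t | q t ≤ x} := fun x =>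
    ⟨x, fun t h => (le_gapPosition hw hs t).trans h⟩
  refine ⟨fun x => denjoyMap ρ w (x + q 0) - q 0, fun x => P (x + q 0), w 0 / 2,
    half_pos (hw 0), by linarith [weight_lt_one hw hs 0], ?_, ?_, ?_, ?_, ?_, ?_, ?_⟩
  · exact (hC.comp (contDiff_id.add contDiff_const)).sub contDiff_const
  · intro x
    have := (((hf' (x + q 0)).comp_add_const x (q 0)).sub_const (q 0)).deriv
    rw [this]; exact hf'pos _
  · intro x
    rw [add_right_comm, denjoyMap_add_one hw hs]; ring
  · intro x y hxy
    exact csSup_le_csSup (hbd _) (hne _) fun t h => le_trans h ((add_le_add_iff_right (q 0)).2 hxy)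
  · intro x
    refine sSup_eq_add_of_translate (fun t => ?_) (hne _) (hbd _)
    have := gapPosition_add_one (ρ := ρ) hw hs (t - 1)
    rw [sub_add_cancel] at this
    simp only [Set.mem_ofPred_eq, hq, this]
    constructor <;> intro h <;> linarith
  · intro x
    refine sSup_eq_add_of_translate (fun t => ?_) (hne _) (hbd _)
    have := denjoyMap_gapPosition (ρ := ρ) hw hs (t - ρ)
    rw [sub_add_cancel] at this
    simp only [Set.mem_ofPred_eq, sub_add_cancel, hq]
    rw [← this, hmono.le_iff_le]
  · intro x h0 hx
    refine (IsLUB.csSup_eq (a := 0) ⟨fun t h => ?_, fun b h => h (by simpa using h0)⟩ (hne _))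
    by_contra! hlt
    have := gapPosition_jump (ρ := ρ) hw hs 0 0 (t := t) (by simpa using hlt)
    simp only [Int.cast_zero, zero_mul, add_zero, ← hq] at this
    have h' : q t ≤ x + q 0 := h
    linarith [hw 0]

/-! ### The torus diffeomorphism as a composition of two fibred maps -/

/-- A `C^1` bump on the circle supported in `[0, ℓ]`, vanishing at `0` and equal to `1` at `Z`. -/
structure IsBump (ℓ : ℝ) (b : ℝ → ℝ) (Z : ℝ) : Prop where
  contDiff : ContDiff ℝ 1 b
  add_one : ∀ x, b (x + 1) = b x
  nonneg : ∀ x, 0 ≤ b x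
  le_one : ∀ x, b x ≤ 1
  zero : b 0 = 0
  pos : 0 < Z
  lt : Z < ℓ
  top : b Z = 1
  support : ∀ x, b x ≠ 0 → ∃ k : ℤ, 0 ≤ x - k ∧ x - k ≤ ℓ

lemma exists_isBump {ℓ : ℝ} (h0 : 0 < ℓ) (h1 : ℓ < 1) : ∃ b Z, IsBump ℓ b Z := by
  obtain ⟨b, Z, h1, h2, h3, h4, h5, h6, h7, h8, h9⟩ := exists_circle_bump h0 h1
  exact ⟨b, Z, h1, h2, h3, h4, h5, h6, h7, h8, h9⟩

lemma map_add_intCast_of_map_add_one {g : ℝ → ℝ} (hg : ∀ x, g (x + 1) = g x + 1) (x : ℝ) (k : ℤ) :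
    g (x + k) = g x + k := by
  induction k using Int.induction_on with
  | zero => simp
  | succ i ih => push_cast at ih ⊢; rw [← add_assoc, hg, ih, add_assoc]
  | pred i ih =>
    have := hg (x + (-(i : ℝ) - 1))
    rw [show x + (-(i : ℝ) - 1) + 1 = x + -(i : ℝ) by ring] at this
    push_cast at ih ⊢
    linarith

lemma IsBump.add_intCast {ℓ Z : ℝ} {b : ℝ → ℝ} (hb : IsBump ℓ b Z) (x : ℝ) (k : ℤ) :
    b (x + k) = b x := by
  have h : Function.Periodic b 1 := hb.add_one
  simpa using h.int_mul k x

/-- The interpolation between the identity and `f`, with parameter `b y`. -/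
def slide (f b : ℝ → ℝ) (y x : ℝ) : ℝ := x + b y * (f x - x)

/-- Horizontal motion by `slide`. -/
def shearX (f b : ℝ → ℝ) (z : ℝ × ℝ) : ℝ × ℝ := (slide f b z.2 z.1, z.2)

/-- Vertical motion by `slide`. -/
def shearY (f b : ℝ → ℝ) (z : ℝ × ℝ) : ℝ × ℝ := (z.1, slide f b z.1 z.2)

/-- The composition of the horizontal and the vertical motion. -/
def kwapiszMap (f b : ℝ → ℝ) (z : ℝ × ℝ) : ℝ × ℝ := shearY f b (shearX f b z)

section Slide

variable {ρ ℓ Z : ℝ} {f p b : ℝ → ℝ}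

lemma IsDenjoy.lt_map (hf : IsDenjoy ρ f p ℓ) (h0 : 0 < ρ) (x : ℝ) : x < f x := by
  by_contra! h
  have := hf.mono h
  rw [hf.semi_map] at this
  linarith

lemma IsDenjoy.strictMono (hf : IsDenjoy ρ f p ℓ) : StrictMono f :=
  strictMono_of_deriv_pos hf.deriv_pos

lemma le_slide (hf : IsDenjoy ρ f p ℓ) (h0 : 0 < ρ) (hb : IsBump ℓ b Z) (y x : ℝ) :
    x ≤ slide f b y x := by
  have := mul_nonneg (hb.nonneg y) (sub_nonneg.2 (hf.lt_map h0 x).le)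
  rw [slide]; linarith

lemma slide_le (hf : IsDenjoy ρ f p ℓ) (h0 : 0 < ρ) (hb : IsBump ℓ b Z) (y x : ℝ) :
    slide f b y x ≤ f x := by
  have := mul_le_mul_of_nonneg_right (hb.le_one y) (sub_nonneg.2 (hf.lt_map h0 x).le)
  rw [slide]; linarith

lemma slide_strictMono (hf : IsDenjoy ρ f p ℓ) (hb : IsBump ℓ b Z) (y : ℝ) :
    StrictMono (slide f b y) := by
  intro u v h
  have h1 := hb.nonneg y
  have h2 := hb.le_one y
  have h3 := hf.strictMono h
  unfold slide
  rcases eq_or_lt_of_le h1 with h4 | h4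
  · rw [← h4]; simpa
  · nlinarith [mul_nonneg (sub_nonneg.2 h2) (sub_nonneg.2 h.le), mul_pos h4 (sub_pos.2 h3)]

lemma slide_of_eq_zero {y : ℝ} (h : b y = 0) (x : ℝ) : slide f b y x = x := by
  simp [slide, h]

lemma slide_of_eq_one {y : ℝ} (h : b y = 1) (x : ℝ) : slide f b y x = f x := by
  simp [slide, h]

lemma slide_add_intCast (hf : IsDenjoy ρ f p ℓ) (y x : ℝ) (k : ℤ) :
    slide f b y (x + k) = slide f b y x + k := by
  rw [slide, slide, map_add_intCast_of_map_add_one hf.map_add_one]; ring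

lemma slide_param_add_intCast (hb : IsBump ℓ b Z) (y x : ℝ) (k : ℤ) :
    slide f b (y + k) x = slide f b y x := by
  rw [slide, slide, hb.add_intCast]

lemma contDiff_slide (hf : IsDenjoy ρ f p ℓ) (hb : IsBump ℓ b Z) :
    ContDiff ℝ 1 fun z : ℝ × ℝ => slide f b z.2 z.1 :=
  contDiff_fst.add ((hb.contDiff.comp contDiff_snd).mul
    ((hf.contDiff.comp contDiff_fst).sub contDiff_fst))

lemma continuous_slide (hf : IsDenjoy ρ f p ℓ) (hb : IsBump ℓ b Z) :
    Continuous fun z : ℝ × ℝ => slide f b z.2 z.1 := (contDiff_slide hf hb).continuous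

lemma slide_surjective (hf : IsDenjoy ρ f p ℓ) (h0 : 0 < ρ) (hb : IsBump ℓ b Z) (y : ℝ) :
    Function.Surjective (slide f b y) := by
  have hc : Continuous (slide f b y) :=
    (continuous_slide hf hb).comp (continuous_id.prodMk continuous_const)
  intro v
  have h1 := le_slide hf h0 hb y v
  set k := ⌈slide f b y v - v⌉ with hk
  have h2 : slide f b y (v + (-k : ℤ)) ≤ v := by
    rw [slide_add_intCast hf]
    push_cast
    linarith [Int.le_ceil (slide f b y v - v)]
  have h3 : (0 : ℤ) ≤ k := Int.ceil_nonneg (by linarith)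
  have h3' : (0 : ℝ) ≤ k := by exact_mod_cast h3
  obtain ⟨x, -, hx⟩ := intermediate_value_Icc (a := v + (-k : ℤ)) (b := v) (by push_cast; linarith)
    hc.continuousOn ⟨h2, h1⟩
  exact ⟨x, hx⟩

lemma slide_deriv_pos (hf : IsDenjoy ρ f p ℓ) (hb : IsBump ℓ b Z) (y x : ℝ) :
    0 < 1 + b y * (deriv f x - 1) := by
  have h1 := hb.nonneg y
  have h2 := hb.le_one y
  have h3 := hf.deriv_pos x
  rcases eq_or_lt_of_le h1 with h4 | h4
  · rw [← h4]; simp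
  · nlinarith [mul_pos h4 h3]

/-- A linear automorphism of the plane preserving the second coordinate. -/
noncomputable def shearEquiv (c d : ℝ) (hc : c ≠ 0) : (ℝ × ℝ) ≃L[ℝ] (ℝ × ℝ) :=
  ContinuousLinearEquiv.equivOfInverse
    ((c • ContinuousLinearMap.fst ℝ ℝ ℝ + d • ContinuousLinearMap.snd ℝ ℝ ℝ).prod
      (ContinuousLinearMap.snd ℝ ℝ ℝ))
    ((c⁻¹ • ContinuousLinearMap.fst ℝ ℝ ℝ - (c⁻¹ * d) • ContinuousLinearMap.snd ℝ ℝ ℝ).prod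
      (ContinuousLinearMap.snd ℝ ℝ ℝ))
    (fun z => by ext <;> simp; field_simp; ring)
    (fun z => by ext <;> simp; field_simp; ring)

lemma exists_shearX_inverse (hf : IsDenjoy ρ f p ℓ) (h0 : 0 < ρ) (hb : IsBump ℓ b Z) :
    ∃ g : ℝ × ℝ → ℝ × ℝ, ContDiff ℝ 1 g ∧ Function.LeftInverse g (shearX f b) ∧
      Function.RightInverse g (shearX f b) := by
  have hC : ContDiff ℝ 1 (shearX f b) := (contDiff_slide hf hb).prodMk contDiff_snd
  have hbij : Function.Bijective (shearX f b) := by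
    constructor
    · rintro ⟨x, y⟩ ⟨x', y'⟩ h
      obtain ⟨h1, rfl⟩ := Prod.mk.inj h
      have h2 : x = x' := (slide_strictMono hf hb y).injective h1
      rw [h2]
    · rintro ⟨x, y⟩
      obtain ⟨x', hx'⟩ := slide_surjective hf h0 hb y x
      exact ⟨(x', y), by simp [shearX, hx']⟩
  have hder : ∀ z : ℝ × ℝ, ∃ e : (ℝ × ℝ) ≃L[ℝ] (ℝ × ℝ),
      HasFDerivAt (shearX f b) (e : (ℝ × ℝ) →L[ℝ] (ℝ × ℝ)) z := by
    intro z
    have h1 : HasDerivAt f (deriv f z.1) z.1 :=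
      (hf.contDiff.differentiable (by simp) z.1).hasDerivAt
    have h2 : HasDerivAt b (deriv b z.2) z.2 :=
      (hb.contDiff.differentiable (by simp) z.2).hasDerivAt
    have h3 := h1.comp_hasFDerivAt z (hasFDerivAt_fst (𝕜 := ℝ) (E := ℝ) (F := ℝ) (p := z))
    have h4 := h2.comp_hasFDerivAt z (hasFDerivAt_snd (𝕜 := ℝ) (E := ℝ) (F := ℝ) (p := z))
    have h5 := ((hasFDerivAt_fst (𝕜 := ℝ) (E := ℝ) (F := ℝ) (p := z)).add
      (h4.mul (h3.sub (hasFDerivAt_fst (𝕜 := ℝ) (E := ℝ) (F := ℝ) (p := z))))).prodMk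
      (hasFDerivAt_snd (𝕜 := ℝ) (E := ℝ) (F := ℝ) (p := z))
    refine ⟨shearEquiv (1 + b z.2 * (deriv f z.1 - 1)) (deriv b z.2 * (f z.1 - z.1))
      (slide_deriv_pos hf hb z.2 z.1).ne', ?_⟩
    refine HasFDerivAt.congr_fderiv h5 ?_
    ext <;> simp [shearEquiv]
    ring
  choose e he using hder
  have hopen : IsOpenMap (shearX f b) := by
    rw [isOpenMap_iff_nhds_le]
    intro z
    have h1 : HasStrictFDerivAt (shearX f b) (e z : (ℝ × ℝ) →L[ℝ] (ℝ × ℝ)) z := by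
      rw [← (he z).fderiv]
      exact hC.contDiffAt.hasStrictFDerivAt (by simp)
    exact h1.map_nhds_eq_of_equiv.ge
  set E := Equiv.ofBijective _ hbij with hE
  set Φ := E.toHomeomorphOfContinuousOpen hC.continuous hopen with hΦ
  exact ⟨Φ.symm, Φ.contDiff_symm he hC, E.symm_apply_apply, E.apply_symm_apply⟩

lemma shearY_eq_swap (f b : ℝ → ℝ) (z : ℝ × ℝ) : shearY f b z = (shearX f b z.swap).swap := rfl

lemma exists_kwapiszMap_inverse (hf : IsDenjoy ρ f p ℓ) (h0 : 0 < ρ) (hb : IsBump ℓ b Z) :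
    ∃ g : ℝ × ℝ → ℝ × ℝ, ContDiff ℝ 1 g ∧ Function.LeftInverse g (kwapiszMap f b) ∧
      Function.RightInverse g (kwapiszMap f b) := by
  obtain ⟨g, hg, hl, hr⟩ := exists_shearX_inverse hf h0 hb
  have hs : ContDiff ℝ 1 (Prod.swap : ℝ × ℝ → ℝ × ℝ) := contDiff_snd.prodMk contDiff_fst
  refine ⟨fun z => g (g z.swap).swap, hg.comp (hs.comp (hg.comp hs)), fun z => ?_, fun z => ?_⟩
  · simp [kwapiszMap, shearY_eq_swap, hl _]
  · simp [kwapiszMap, shearY_eq_swap, hr _]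

lemma contDiff_kwapiszMap (hf : IsDenjoy ρ f p ℓ) (hb : IsBump ℓ b Z) :
    ContDiff ℝ 1 (kwapiszMap f b) := by
  have hs : ContDiff ℝ 1 (Prod.swap : ℝ × ℝ → ℝ × ℝ) := contDiff_snd.prodMk contDiff_fst
  have hC : ContDiff ℝ 1 (shearX f b) := (contDiff_slide hf hb).prodMk contDiff_snd
  exact hs.comp (hC.comp (hs.comp hC))

lemma kwapiszMap_add_intCast (hf : IsDenjoy ρ f p ℓ) (hb : IsBump ℓ b Z) (z : ℝ × ℝ) (v : ℤ × ℤ) :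
    kwapiszMap f b (z + ((v.1 : ℝ), (v.2 : ℝ))) = kwapiszMap f b z + ((v.1 : ℝ), (v.2 : ℝ)) := by
  ext <;> simp [kwapiszMap, shearX, shearY, slide_add_intCast hf, slide_param_add_intCast hb]

end Slide

/-! ### Upper bound for the rotation set -/

/-- `D` belongs to the dilation of `Λ_ρ` by the factor `t`. -/
def InCone (ρ t : ℝ) (D : ℝ × ℝ) : Prop := ∃ v ∈ LambdaSet ρ, D = t • v

section Cone

variable {ρ : ℝ}

lemma convex_lambdaSet (ρ : ℝ) : Convex ℝ (LambdaSet ρ) := (convex_convexHull ℝ _).closure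

lemma zero_mem_lambdaSet (ρ : ℝ) : (0 : ℝ × ℝ) ∈ LambdaSet ρ :=
  subset_closure (subset_convexHull ℝ _ (Or.inl rfl))

lemma inCone_zero (ρ t : ℝ) : InCone ρ t 0 := ⟨0, zero_mem_lambdaSet ρ, by simp⟩

lemma InCone.add {s t : ℝ} {D E : ℝ × ℝ} (hs : 0 ≤ s) (ht : 0 ≤ t) (hD : InCone ρ s D)
    (hE : InCone ρ t E) : InCone ρ (s + t) (D + E) := by
  obtain ⟨v, hv, rfl⟩ := hD
  obtain ⟨w, hw, rfl⟩ := hE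
  rcases (add_nonneg hs ht).eq_or_lt with h | h
  · obtain rfl : s = 0 := by linarith
    obtain rfl : t = 0 := by linarith
    simpa using inCone_zero ρ 0
  · refine ⟨(s / (s + t)) • v + (t / (s + t)) • w, convex_lambdaSet ρ hv hw (by positivity)
      (by positivity) (by field_simp), ?_⟩
    rw [smul_add, smul_smul, smul_smul, mul_div_cancel₀ _ h.ne', mul_div_cancel₀ _ h.ne']

lemma InCone.mono {s t : ℝ} {D : ℝ × ℝ} (hs : 0 ≤ s) (hst : s ≤ t) (hD : InCone ρ s D) :
    InCone ρ t D := by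
  simpa using hD.add hs (sub_nonneg.2 hst) (inCone_zero ρ (t - s))

/-- The least positive number of rotations by `ρ` that can achieve the displacement `j`. -/
noncomputable def hitTime (ρ : ℝ) (j : ℤ) : ℕ := max 1 ⌈(j : ℝ) / ρ⌉₊

lemma one_le_hitTime (ρ : ℝ) (j : ℤ) : 1 ≤ hitTime ρ j := le_max_left _ _

lemma hitTime_le (h0 : 0 < ρ) {j : ℤ} {M : ℕ} (hM : 1 ≤ M) (h : (j : ℝ) ≤ M * ρ) :
    hitTime ρ j ≤ M :=
  max_le hM (Nat.ceil_le.2 ((div_le_iff₀ h0).2 h))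

lemma ceil_hitTime (hirr : Irrational ρ) (h0 : 0 < ρ) (h1 : ρ < 1) {j : ℤ} (hj : 0 ≤ j) :
    ⌈((hitTime ρ j - 1 : ℕ) : ℝ) * ρ⌉ = j ∧ alphaSeq ρ (hitTime ρ j - 1) < ρ := by
  have hcast : ((hitTime ρ j - 1 : ℕ) : ℝ) = hitTime ρ j - 1 := by
    rw [Nat.cast_sub (one_le_hitTime ρ j)]; simp
  have hle : (j : ℝ) ≤ hitTime ρ j * ρ := by
    rw [← div_le_iff₀ h0]
    refine (Nat.le_ceil _).trans ?_
    exact_mod_cast le_max_right _ _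
  have hlt : (j : ℝ) < hitTime ρ j * ρ := by
    refine lt_of_le_of_ne hle fun h => ?_
    have h2 := hirr.natCast_mul (m := hitTime ρ j) (by have := one_le_hitTime ρ j; omega)
    rw [← h] at h2
    exact (Int.not_irrational j) h2
  have hge : ((hitTime ρ j : ℝ) - 1) * ρ ≤ j := by
    rcases hj.eq_or_lt with rfl | h
    · simp [hitTime]
    · have h3 : (0 : ℝ) < j := by exact_mod_cast h
      have h4 : (⌈(j : ℝ) / ρ⌉₊ : ℝ) < j / ρ + 1 := Nat.ceil_lt_add_one (by positivity)
      have h5 : 1 ≤ ⌈(j : ℝ) / ρ⌉₊ := Nat.one_le_iff_ne_zero.2 (by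
        rw [Ne, Nat.ceil_eq_zero]; push Not; positivity)
      rw [hitTime, max_eq_right h5, ← le_div_iff₀ h0]
      linarith
  have hceil : ⌈((hitTime ρ j - 1 : ℕ) : ℝ) * ρ⌉ = j := by
    rw [Int.ceil_eq_iff, hcast]
    constructor <;> linarith
  refine ⟨hceil, ?_⟩
  rw [alphaSeq, hceil, hcast]
  linarith

lemma inCone_hitTime (hirr : Irrational ρ) (h0 : 0 < ρ) (h1 : ρ < 1) {j k : ℤ} (hj : 0 ≤ j)
    (hk : 0 ≤ k) : InCone ρ ((hitTime ρ j : ℝ) + hitTime ρ k - 1) ((j : ℝ), (k : ℝ)) := by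
  obtain ⟨h2, h3⟩ := ceil_hitTime hirr h0 h1 hj
  obtain ⟨h4, h5⟩ := ceil_hitTime hirr h0 h1 hk
  refine ⟨vecRho ρ (hitTime ρ j - 1) (hitTime ρ k - 1),
    subset_closure (subset_convexHull ℝ _ (Or.inr ⟨_, _, h3, h5, rfl⟩)), ?_⟩
  have h6 : (1 : ℝ) ≤ hitTime ρ j := by exact_mod_cast one_le_hitTime ρ j
  have h7 : (1 : ℝ) ≤ hitTime ρ k := by exact_mod_cast one_le_hitTime ρ k
  rw [vecRho, h2, h4, Nat.cast_sub (one_le_hitTime ρ j), Nat.cast_sub (one_le_hitTime ρ k)]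
  have h8 : (hitTime ρ j : ℝ) - (1 : ℕ) + (hitTime ρ k - (1 : ℕ)) + 1
      = hitTime ρ j + hitTime ρ k - 1 := by push_cast; ring
  have h9 : (hitTime ρ j : ℝ) + hitTime ρ k - 1 ≠ 0 := by linarith
  rw [h8]
  ext <;> simp <;> field_simp

end Cone

section Itinerary

variable {ρ ℓ Z : ℝ} {f p b : ℝ → ℝ}

lemma IsBump.eq_zero (hb : IsBump ℓ b Z) {x : ℝ} (h : ¬∃ k : ℤ, 0 ≤ x - k ∧ x - k ≤ ℓ) :
    b x = 0 := by
  by_contra h2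
  exact h (hb.support x h2)

lemma IsDenjoy.semi_iterate (hf : IsDenjoy ρ f p ℓ) (i : ℕ) (x : ℝ) :
    p (f^[i] x) = p x + i * ρ := by
  induction i with
  | zero => simp
  | succ i ih => rw [Function.iterate_succ_apply', hf.semi_map, ih]; push_cast; ring

lemma IsDenjoy.semi_add_intCast (hf : IsDenjoy ρ f p ℓ) (x : ℝ) (k : ℤ) : p (x + k) = p x + k :=
  map_add_intCast_of_map_add_one hf.semi_add_one x k

lemma IsDenjoy.semi_eq_intCast (hf : IsDenjoy ρ f p ℓ) {x : ℝ} {k : ℤ} (h : 0 ≤ x - k)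
    (h' : x - k ≤ ℓ) : p x = k := by
  have := hf.semi_add_intCast (x - k) k
  rwa [hf.semi_gap _ h h', sub_add_cancel, zero_add] at this

lemma IsDenjoy.semi_intCast (hf : IsDenjoy ρ f p ℓ) (k : ℤ) : p k = k :=
  hf.semi_eq_intCast (by simp) (by simpa using hf.pos.le)

lemma IsDenjoy.displacement_le (hf : IsDenjoy ρ f p ℓ) {x x' : ℝ} {i : ℕ} {a k : ℤ} (hx0 : 0 ≤ x')
    (hx1 : x' ≤ ℓ) (h : x ≤ f^[i] x' + a) (hk : (k : ℝ) ≤ x) : ((k - a : ℤ) : ℝ) ≤ i * ρ := by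
  have h1 := hf.mono h
  have h2 := hf.mono hk
  rw [hf.semi_add_intCast, hf.semi_iterate, hf.semi_gap _ hx0 hx1] at h1
  rw [hf.semi_intCast] at h2
  push_cast
  linarith

lemma IsDenjoy.le_of_mem_gap (hf : IsDenjoy ρ f p ℓ) {x : ℝ} {a k : ℤ} (ha : (a : ℝ) ≤ x)
    (h : 0 ≤ x - k) (h' : x - k ≤ ℓ) : a ≤ k := by
  have h1 := hf.mono ha
  rw [hf.semi_intCast, hf.semi_eq_intCast h h'] at h1
  exact_mod_cast h1

lemma slide_le_iterate (hf : IsDenjoy ρ f p ℓ) (h0 : 0 < ρ) (hb : IsBump ℓ b Z) {x x' y : ℝ}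
    {i : ℕ} {a : ℤ} (h : x ≤ f^[i] x' + a) : slide f b y x ≤ f^[i + 1] x' + a := by
  refine (slide_le hf h0 hb y x).trans ((hf.strictMono.monotone h).trans_eq ?_)
  rw [map_add_intCast_of_map_add_one hf.map_add_one, Function.iterate_succ_apply']

/-- `x` has moved from the integer `a`, at most as fast as a point of the gap during `i` steps. -/
def Moved (f : ℝ → ℝ) (ℓ : ℝ) (i : ℕ) (a : ℤ) (x : ℝ) : Prop :=
  ∃ x', 0 ≤ x' ∧ x' ≤ ℓ ∧ (a : ℝ) ≤ x ∧ x ≤ f^[i] x' + a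

/-- A bookkeeping invariant for orbits of `kwapiszMap`, relative to the base point `o`. -/
inductive Itinerary (ρ : ℝ) (f : ℝ → ℝ) (ℓ : ℝ) (o : ℝ × ℝ) : ℝ → ℝ × ℝ → Prop
  | horizontal (t : ℝ) (x y : ℝ) (a c : ℤ) (i : ℕ) : 0 ≤ y - c → y - c ≤ ℓ → Moved f ℓ i a x →
      0 ≤ t - i → InCone ρ (t - i) (((a : ℝ), (c : ℝ)) - o) → Itinerary ρ f ℓ o t (x, y)
  | vertical (t : ℝ) (x y : ℝ) (a c : ℤ) (i : ℕ) : 0 ≤ x - a → x - a ≤ ℓ →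
      (¬∃ k : ℤ, 0 ≤ y - k ∧ y - k ≤ ℓ) → 1 ≤ i → Moved f ℓ i c y → 0 ≤ t - i + 1 →
      (∀ k : ℤ, 0 ≤ k → InCone ρ (t - i + hitTime ρ k) (((a : ℝ), (c : ℝ) + k) - o)) →
      Itinerary ρ f ℓ o t (x, y)
  | fixed (t : ℝ) (x y : ℝ) : (¬∃ k : ℤ, 0 ≤ x - k ∧ x - k ≤ ℓ) →
      (¬∃ k : ℤ, 0 ≤ y - k ∧ y - k ≤ ℓ) → 0 ≤ t →
      InCone ρ t (((⌊x⌋ : ℝ), (⌊y⌋ : ℝ)) - o) → Itinerary ρ f ℓ o t (x, y)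

lemma Moved.slide (hf : IsDenjoy ρ f p ℓ) (h0 : 0 < ρ) (hb : IsBump ℓ b Z) {i : ℕ} {a : ℤ} {x : ℝ}
    (h : Moved f ℓ i a x) (y : ℝ) : Moved f ℓ (i + 1) a (slide f b y x) := by
  obtain ⟨x', h1, h2, h3, h4⟩ := h
  exact ⟨x', h1, h2, h3.trans (le_slide hf h0 hb y x), slide_le_iterate hf h0 hb h4⟩

lemma Moved.of_mem_gap (x : ℝ) {a : ℤ} (h : 0 ≤ x - a) (h' : x - a ≤ ℓ) : Moved f ℓ 0 a x :=
  ⟨x - a, h, h', by linarith, by simp⟩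

/-- The vertical state, when the second coordinate is possibly in a gap. -/
lemma Itinerary.of_vertical (hf : IsDenjoy ρ f p ℓ) (h0 : 0 < ρ) {o : ℝ × ℝ} {t x y : ℝ}
    {a c : ℤ} {i : ℕ} (hx : 0 ≤ x - a) (hx' : x - a ≤ ℓ) (hi : 1 ≤ i) (hy : Moved f ℓ i c y)
    (ht : 0 ≤ t - i + 1)
    (hk : ∀ k : ℤ, 0 ≤ k → InCone ρ (t - i + hitTime ρ k) (((a : ℝ), (c : ℝ) + k) - o)) :
    Itinerary ρ f ℓ o t (x, y) := by
  by_cases h : ∃ k : ℤ, 0 ≤ y - k ∧ y - k ≤ ℓ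
  · obtain ⟨k, h2, h3⟩ := h
    obtain ⟨y', h4, h5, h6, h7⟩ := hy
    have h8 : (0 : ℤ) ≤ k - c := sub_nonneg.2 (hf.le_of_mem_gap h6 h2 h3)
    have h9 := hf.displacement_le h4 h5 h7 (sub_nonneg.1 h2)
    have h10 : (hitTime ρ (k - c) : ℝ) ≤ i := by exact_mod_cast hitTime_le h0 hi h9
    have h11 : (1 : ℝ) ≤ hitTime ρ (k - c) := by exact_mod_cast one_le_hitTime ρ _
    have h12 := (hk _ h8).mono (t := t) (by linarith) (by linarith)
    rw [show (c : ℝ) + ((k - c : ℤ) : ℝ) = k by push_cast; ring] at h12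
    refine .horizontal t x y a k 0 h2 h3 (Moved.of_mem_gap x hx hx') ?_ ?_
    · simp; linarith
    · simpa using h12
  · exact .vertical t x y a c i hx hx' h hi hy ht hk

lemma Itinerary.step (hirr : Irrational ρ) (h0 : 0 < ρ) (h1 : ρ < 1) (hf : IsDenjoy ρ f p ℓ)
    (hb : IsBump ℓ b Z) {o : ℝ × ℝ} {t : ℝ} {z : ℝ × ℝ} (h : Itinerary ρ f ℓ o t z) :
    Itinerary ρ f ℓ o (t + 1) (kwapiszMap f b z) := by
  cases h with
  | horizontal x y a c i hy hy' hx ht hc =>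
    have hx1 := hx.slide hf h0 hb y
    by_cases hg : ∃ k : ℤ, 0 ≤ slide f b y x - k ∧ slide f b y x - k ≤ ℓ
    · obtain ⟨k, h2, h3⟩ := hg
      obtain ⟨x', h4, h5, h6, h7⟩ := hx1
      have h8 : (0 : ℤ) ≤ k - a := sub_nonneg.2 (hf.le_of_mem_gap h6 h2 h3)
      have h9 := hf.displacement_le h4 h5 h7 (sub_nonneg.1 h2)
      have h10 : (hitTime ρ (k - a) : ℝ) ≤ i + 1 := by
        exact_mod_cast hitTime_le h0 (by omega) h9
      have h11 : (1 : ℝ) ≤ hitTime ρ (k - a) := by exact_mod_cast one_le_hitTime ρ _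
      refine Itinerary.of_vertical hf h0 (a := k) (c := c) (i := 1) h2 h3 le_rfl
        ((Moved.of_mem_gap y hy hy').slide hf h0 hb _) ?_ fun m hm => ?_
      · have : (0 : ℝ) ≤ i := by positivity
        push_cast; linarith
      · have h12 : (1 : ℝ) ≤ hitTime ρ m := by exact_mod_cast one_le_hitTime ρ _
        have h13 := hc.add ht (by linarith) (inCone_hitTime hirr h0 h1 h8 hm)
        convert h13.mono (t := t + 1 - (1 : ℕ) + hitTime ρ m) (by linarith)
          (by push_cast; linarith) using 1
        ext <;> simp; ring
    · have : kwapiszMap f b (x, y) = (slide f b y x, y) := by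
        simp [kwapiszMap, shearX, shearY, slide_of_eq_zero (hb.eq_zero hg)]
      rw [this]
      have h2 : t + 1 - ((i + 1 : ℕ) : ℝ) = t - i := by push_cast; ring
      exact .horizontal _ _ _ a c (i + 1) hy hy' hx1 (h2 ▸ ht) (h2 ▸ hc)
  | vertical x y a c i hx hx' hy hi hm ht hc =>
    have : kwapiszMap f b (x, y) = (x, slide f b x y) := by
      simp [kwapiszMap, shearX, shearY, slide_of_eq_zero (hb.eq_zero hy)]
    rw [this]
    have h2 : t + 1 - ((i + 1 : ℕ) : ℝ) = t - i := by push_cast; ring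
    exact Itinerary.of_vertical hf h0 hx hx' (by omega) (hm.slide hf h0 hb x) (h2 ▸ ht) (h2 ▸ hc)
  | fixed x y hx hy ht hc =>
    have : kwapiszMap f b (x, y) = (x, y) := by
      simp [kwapiszMap, shearX, shearY, slide_of_eq_zero (hb.eq_zero hy),
        slide_of_eq_zero (hb.eq_zero hx)]
    rw [this]
    exact .fixed _ x y hx hy (by linarith) (hc.mono ht (by linarith))

lemma IsDenjoy.eq_floor (hf : IsDenjoy ρ f p ℓ) {x : ℝ} {k : ℤ} (h : 0 ≤ x - k)
    (h' : x - k ≤ ℓ) : k = ⌊x⌋ := by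
  have := hf.lt_one
  exact (Int.floor_eq_iff.2 ⟨by linarith, by linarith⟩).symm

lemma Itinerary.start (hirr : Irrational ρ) (h0 : 0 < ρ) (h1 : ρ < 1) (hf : IsDenjoy ρ f p ℓ)
    {i : ℕ} (hi : 1 ≤ f^[i] 0) (z : ℝ × ℝ) :
    Itinerary ρ f ℓ ((⌊z.1⌋ : ℝ), (⌊z.2⌋ : ℝ)) i z := by
  have hm : ∀ x : ℝ, Moved f ℓ i ⌊x⌋ x := fun x =>
    ⟨0, le_rfl, hf.pos.le, Int.floor_le x, by linarith [Int.lt_floor_add_one x]⟩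
  have hi1 : 1 ≤ i := by
    by_contra! h
    obtain rfl : i = 0 := by omega
    norm_num at hi
  obtain ⟨x, y⟩ := z
  by_cases hx : ∃ k : ℤ, 0 ≤ x - k ∧ x - k ≤ ℓ
  · obtain ⟨k, h2, h3⟩ := hx
    obtain rfl := hf.eq_floor h2 h3
    refine Itinerary.of_vertical hf h0 h2 h3 hi1 (hm y) (by simp) fun k hk => ?_
    convert inCone_hitTime hirr h0 h1 le_rfl hk using 1
    · simp [hitTime]
    · ext <;> simp
  by_cases hy : ∃ k : ℤ, 0 ≤ y - k ∧ y - k ≤ ℓ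
  · obtain ⟨k, h2, h3⟩ := hy
    obtain rfl := hf.eq_floor h2 h3
    refine .horizontal _ _ _ ⌊x⌋ ⌊y⌋ i h2 h3 (hm x) (by simp) ?_
    simpa using inCone_zero ρ 0
  · refine .fixed _ _ _ hx hy (by positivity) ?_
    simpa using inCone_zero ρ i

lemma Itinerary.inCone_floor (hirr : Irrational ρ) (h0 : 0 < ρ) (h1 : ρ < 1)
    (hf : IsDenjoy ρ f p ℓ) {o : ℝ × ℝ} {t : ℝ} {z : ℝ × ℝ} (h : Itinerary ρ f ℓ o t z) :
    InCone ρ (t + 1) (((⌊z.1⌋ : ℝ), (⌊z.2⌋ : ℝ)) - o) := by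
  cases h with
  | horizontal x y a c i hy hy' hx ht hc =>
    obtain rfl := hf.eq_floor hy hy'
    obtain ⟨x', h4, h5, h6, h7⟩ := hx
    have h8 : (0 : ℤ) ≤ ⌊x⌋ - a := sub_nonneg.2 (Int.le_floor.2 h6)
    have h9 := hf.displacement_le h4 h5 h7 (Int.floor_le x)
    have h10 : (hitTime ρ (⌊x⌋ - a) : ℝ) ≤ i + 1 := by
      exact_mod_cast hitTime_le (M := i + 1) h0 (by omega) (h9.trans (by push_cast; linarith))
    have h11 : (1 : ℝ) ≤ hitTime ρ (⌊x⌋ - a) := by exact_mod_cast one_le_hitTime ρ _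
    have h14 : hitTime ρ 0 = 1 := by simp [hitTime]
    have h13 := hc.add ht (by rw [h14]; push_cast; linarith)
      (inCone_hitTime hirr h0 h1 h8 le_rfl)
    rw [h14] at h13
    convert h13.mono (t := t + 1) (by push_cast; linarith) (by push_cast; linarith) using 1
    ext <;> simp
  | vertical x y a c i hx hx' hy hi hm ht hc =>
    obtain rfl := hf.eq_floor hx hx'
    obtain ⟨y', h4, h5, h6, h7⟩ := hm
    have h8 : (0 : ℤ) ≤ ⌊y⌋ - c := sub_nonneg.2 (Int.le_floor.2 h6)
    have h9 := hf.displacement_le h4 h5 h7 (Int.floor_le y)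
    have h10 : (hitTime ρ (⌊y⌋ - c) : ℝ) ≤ i := by exact_mod_cast hitTime_le h0 hi h9
    have h11 : (1 : ℝ) ≤ hitTime ρ (⌊y⌋ - c) := by exact_mod_cast one_le_hitTime ρ _
    have h12 := (hc _ h8).mono (t := t + 1) (by linarith) (by linarith)
    rwa [show (c : ℝ) + ((⌊y⌋ - c : ℤ) : ℝ) = ⌊y⌋ by push_cast; ring] at h12
  | fixed x y hx hy ht hc => exact hc.mono ht (by linarith)

lemma IsDenjoy.exists_one_le_iterate (hf : IsDenjoy ρ f p ℓ) (h0 : 0 < ρ) :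
    ∃ i : ℕ, 1 ≤ f^[i] 0 := by
  obtain ⟨i, hi⟩ := exists_nat_gt (1 / ρ)
  refine ⟨i, ?_⟩
  by_contra! h
  have h2 := hf.mono h.le
  have h3 := hf.semi_intCast 1
  rw [hf.semi_iterate, hf.semi_gap 0 le_rfl hf.pos.le] at h2
  rw [div_lt_iff₀ h0] at hi
  push_cast at h3
  linarith

theorem rotSet_subset (hirr : Irrational ρ) (h0 : 0 < ρ) (h1 : ρ < 1) (hf : IsDenjoy ρ f p ℓ)
    (hb : IsBump ℓ b Z) : rotSet (kwapiszMap f b) ⊆ LambdaSet ρ := by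
  obtain ⟨i, hi⟩ := hf.exists_one_le_iterate h0
  have key : ∀ (n : ℕ) (z : ℝ × ℝ), InCone ρ (n + (i + 1))
      (((⌊((kwapiszMap f b)^[n] z).1⌋ : ℝ), (⌊((kwapiszMap f b)^[n] z).2⌋ : ℝ)) -
        ((⌊z.1⌋ : ℝ), (⌊z.2⌋ : ℝ))) := by
    intro n z
    have h2 : Itinerary ρ f ℓ ((⌊z.1⌋ : ℝ), (⌊z.2⌋ : ℝ)) (n + i) ((kwapiszMap f b)^[n] z) := by
      induction n with
      | zero => simpa using Itinerary.start hirr h0 h1 hf hi z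
      | succ n ih =>
        rw [Function.iterate_succ_apply']
        convert ih.step hirr h0 h1 hf hb using 1
        push_cast; ring
    rw [← add_assoc]
    exact h2.inCone_floor hirr h0 h1 hf
  intro w hw
  have hcl : closure (LambdaSet ρ) = LambdaSet ρ := isClosed_closure.closure_eq
  rw [← hcl, Metric.mem_closure_iff]
  intro ε hε
  set δ := min 1 (ε / 2) with hδ
  have hδ0 : 0 < δ := by positivity
  obtain ⟨m, hm⟩ := exists_nat_gt (2 / ε * ((i + 1) * (‖w‖ + 1) + 1))
  have hw' := Set.mem_iInter.1 hw m
  obtain ⟨u, hu, hwu⟩ := Metric.mem_closure_iff.1 hw' δ hδ0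
  obtain ⟨n, hn, z, rfl⟩ := Set.mem_iUnion₂.1 hu
  set u := (n : ℝ)⁻¹ • ((kwapiszMap f b)^[n] z - z) with hu'
  obtain ⟨v, hv, he⟩ := key n z
  have hmn : (m : ℝ) < n := by exact_mod_cast hn
  have hn0 : (0 : ℝ) < n := by
    have : (0 : ℝ) ≤ m := by positivity
    linarith
  refine ⟨v, hv, ?_⟩
  set q := (kwapiszMap f b)^[n] z with hq
  have h3 : ‖((n : ℝ) + (i + 1)) • v - (n : ℝ) • u‖ ≤ 1 := by
    rw [← he, hu', smul_smul, mul_inv_cancel₀ hn0.ne', one_smul]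
    have h4 : ∀ x y : ℝ, ‖((⌊x⌋ : ℝ) - ⌊y⌋) - (x - y)‖ ≤ 1 := fun x y => by
      rw [Real.norm_eq_abs, abs_le]
      constructor <;> linarith [Int.floor_le x, Int.floor_le y, Int.lt_floor_add_one x,
        Int.lt_floor_add_one y]
    exact norm_prod_le_iff.2 ⟨h4 q.1 z.1, h4 q.2 z.2⟩
  have h5 : ‖u‖ ≤ ‖w‖ + 1 := by
    have h6 : ‖u - w‖ < δ := by rwa [← dist_eq_norm, dist_comm]
    have h7 := norm_le_norm_add_norm_sub w u
    rw [norm_sub_rev] at h7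
    linarith [min_le_left 1 (ε / 2)]
  have h8 : ‖((n : ℝ) + (i + 1)) • (u - v)‖ ≤ (i + 1) * (‖w‖ + 1) + 1 := by
    have h9 : ((n : ℝ) + (i + 1)) • (u - v) =
        ((i : ℝ) + 1) • u - (((n : ℝ) + (i + 1)) • v - (n : ℝ) • u) := by module
    rw [h9]
    refine (norm_sub_le _ _).trans (add_le_add ?_ h3)
    rw [norm_smul, Real.norm_of_nonneg (by positivity)]
    gcongr
  have h10 : ‖u - v‖ < ε / 2 := by
    rw [norm_smul, Real.norm_of_nonneg (by positivity)] at h8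
    rw [div_mul_eq_mul_div, div_lt_iff₀ hε] at hm
    have h11 : (n : ℝ) * ‖u - v‖ ≤ (i + 1) * (‖w‖ + 1) + 1 := by
      refine le_trans ?_ h8
      gcongr
      linarith [show (0 : ℝ) ≤ i by positivity]
    by_contra! h12
    nlinarith [mul_le_mul_of_nonneg_left h12 hn0.le, mul_lt_mul_of_pos_right hmn hε]
  calc dist w v ≤ dist w u + dist u v := dist_triangle _ _ _
    _ < ε / 2 + ε / 2 := add_lt_add (hwu.trans_le (min_le_right _ _)) (by rwa [dist_eq_norm])
    _ = ε := by ring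

end Itinerary

/-! ### Realizing rational rotation vectors -/

/-- `M > 1` and `M * ρ` is closer to `ℤ` from above than all previous positive multiples of `ρ`. -/
def IsRecord (ρ : ℝ) (M : ℕ) : Prop :=
  1 < M ∧ ∀ i : ℕ, 0 < i → i < M → Int.fract (M * ρ) < Int.fract (i * ρ)

section Crossing

lemma exists_first_hit {g : ℝ → ℝ} (hg : Continuous g) {r s c : ℝ} (hrs : r ≤ s) (hr : g r ≤ c)
    (hs : c ≤ g s) : ∃ t, r ≤ t ∧ t ≤ s ∧ g t = c ∧ ∀ q, r ≤ q → q ≤ t → g q ≤ c := by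
  obtain ⟨t, ⟨⟨h1, h2⟩, h3⟩, ht⟩ := (isCompact_Icc.inter_right
    (isClosed_le continuous_const hg) : IsCompact (Set.Icc r s ∩ {q | c ≤ g q})).exists_isLeast
    ⟨s, ⟨hrs, le_rfl⟩, hs⟩
  obtain ⟨q, ⟨h4, h5⟩, h6⟩ := intermediate_value_Icc h1 hg.continuousOn ⟨hr, h3⟩
  have h7 : q = t := le_antisymm h5 (ht ⟨⟨h4, h5.trans h2⟩, h6.ge⟩)
  refine ⟨t, h1, h2, h7 ▸ h6, fun w hw hwt => ?_⟩
  by_contra! h8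
  have h9 : w = t := le_antisymm hwt (ht ⟨⟨hw, hwt.trans h2⟩, h8.le⟩)
  rw [h9, ← h7, h6] at h8
  exact h8.false

lemma exists_last_hit {g : ℝ → ℝ} (hg : Continuous g) {r s c : ℝ} (hrs : r ≤ s) (hr : g r ≤ c)
    (hs : c ≤ g s) : ∃ t, r ≤ t ∧ t ≤ s ∧ g t = c ∧ ∀ q, t ≤ q → q ≤ s → c ≤ g q := by
  obtain ⟨t, h1, h2, h3, h4⟩ := exists_first_hit (g := fun q => -g (-q)) (c := -c)
    (hg.comp continuous_neg).neg (neg_le_neg hrs) (by simpa) (by simpa)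
  refine ⟨-t, by linarith, by linarith, by linarith, fun q hq hq' => ?_⟩
  have := h4 (-q) (by linarith) (by linarith)
  simp only [neg_neg] at this
  linarith

lemma exists_crossing {g : ℝ → ℝ} (hg : Continuous g) {r s c d : ℝ} (hrs : r ≤ s) (hr : g r ≤ c)
    (hcd : c ≤ d) (hs : d ≤ g s) : ∃ t t', r ≤ t ∧ t ≤ t' ∧ t' ≤ s ∧ g t = c ∧ g t' = d ∧
      ∀ q, t ≤ q → q ≤ t' → c ≤ g q ∧ g q ≤ d := by
  obtain ⟨t, h1, h2, h3, h4⟩ := exists_last_hit hg hrs hr (hcd.trans hs)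
  obtain ⟨t', h5, h6, h7, h8⟩ := exists_first_hit hg h2 (h3.trans_le hcd) hs
  exact ⟨t, t', h1, h5, h6, h3, h7, fun q hq hq' => ⟨h4 q hq (hq'.trans h6), h8 q hq hq'⟩⟩

end Crossing

section Realize

variable {ρ ℓ Z : ℝ} {f p b : ℝ → ℝ}

lemma Moved.slide_iterate (hf : IsDenjoy ρ f p ℓ) (h0 : 0 < ρ) (hb : IsBump ℓ b Z) {i : ℕ} {a : ℤ}
    {x : ℝ} (h : Moved f ℓ i a x) (y : ℝ) (n : ℕ) :
    Moved f ℓ (i + n) a ((_root_.slide f b y)^[n] x) := by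
  induction n with
  | zero => exact h
  | succ n ih => rw [Function.iterate_succ_apply']; exact ih.slide hf h0 hb y

lemma Moved.displacement_le (hf : IsDenjoy ρ f p ℓ) {i : ℕ} {a k : ℤ} {x : ℝ}
    (h : Moved f ℓ i a x) (hk : (k : ℝ) ≤ x) : (k : ℝ) - a ≤ i * ρ := by
  obtain ⟨x', h1, h2, -, h4⟩ := h
  exact_mod_cast hf.displacement_le h1 h2 h4 hk

/-- Between record times an orbit going from gap to gap avoids all the other gaps. -/
lemma bump_iterate_eq_zero (hf : IsDenjoy ρ f p ℓ) (h0 : 0 < ρ) (hb : IsBump ℓ b Z) {M : ℕ}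
    (hM : ∀ i : ℕ, 0 < i → i < M → Int.fract (M * ρ) < Int.fract (i * ρ)) {x y : ℝ} (hx : 0 ≤ x)
    (hx' : x ≤ ℓ) (h : 0 ≤ (slide f b y)^[M] x - ⌊M * ρ⌋) {i : ℕ} (hi : 0 < i) (hiM : i < M) :
    b ((slide f b y)^[i] x) = 0 := by
  refine hb.eq_zero ?_
  rintro ⟨k, h1, h2⟩
  have hm : Moved f ℓ 0 0 x := Moved.of_mem_gap x (by simpa) (by simpa)
  have h3 := (hm.slide_iterate hf h0 hb y i).displacement_le hf (sub_nonneg.1 h1)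
  have h4 := (((Moved.of_mem_gap (f := f) _ h1 h2).slide_iterate hf h0 hb y
    (M - i))).displacement_le (k := ⌊M * ρ⌋) hf (by
      rw [← Function.iterate_add_apply, Nat.sub_add_cancel hiM.le]; linarith)
  have h5 := hM i hi hiM
  simp only [zero_add, Int.cast_zero, sub_zero] at h3 h4
  rw [Nat.cast_sub hiM.le] at h4
  have h6 : (k : ℝ) ≤ ⌊i * ρ⌋ := by exact_mod_cast Int.le_floor.2 h3
  rw [Int.fract, Int.fract] at h5
  linarith

lemma kwapiszMap_iterate_add (hf : IsDenjoy ρ f p ℓ) (hb : IsBump ℓ b Z) (n : ℕ) (x y : ℝ)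
    (j k : ℤ) : (kwapiszMap f b)^[n] (x + j, y + k)
      = (kwapiszMap f b)^[n] (x, y) + ((j : ℝ), (k : ℝ)) := by
  induction n with
  | zero => simp
  | succ n ih =>
    rw [Function.iterate_succ_apply', Function.iterate_succ_apply', ih]
    exact kwapiszMap_add_intCast hf hb _ (j, k)

/-- A trip from gap to gap: `M` horizontal steps followed by `N` vertical ones. -/
lemma kwapiszMap_iterate_trip (hb : IsBump ℓ b Z) {M N : ℕ} (hM : 1 ≤ M)
    {x y x₁ : ℝ} {j : ℤ} (hx₁ : (slide f b y)^[M] x = x₁ + j)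
    (h : ∀ i, 0 < i → i < M → b ((slide f b y)^[i] x) = 0)
    (h' : ∀ i, 0 < i → i < N → b ((slide f b x₁)^[i] y) = 0) (hN : 1 ≤ N) :
    (kwapiszMap f b)^[M + N - 1] (x, y) = (x₁ + j, (slide f b x₁)^[N] y) := by
  have h1 : ∀ i, i < M → (kwapiszMap f b)^[i] (x, y) = ((slide f b y)^[i] x, y) := by
    intro i
    induction i with
    | zero => simp
    | succ i ih =>
      intro hi
      rw [Function.iterate_succ_apply', ih (by omega)]
      have h2 := h (i + 1) (by omega) hi
      rw [Function.iterate_succ_apply'] at h2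
      simp only [kwapiszMap, shearX, shearY, slide_of_eq_zero h2]
      rw [← Function.iterate_succ_apply' (slide f b y)]
  have h3 : ∀ i, i < N →
      (kwapiszMap f b)^[M + i] (x, y) = (x₁ + j, (slide f b x₁)^[i + 1] y) := by
    intro i
    induction i with
    | zero =>
      intro _
      obtain ⟨m, rfl⟩ : ∃ m, M = m + 1 := ⟨M - 1, by omega⟩
      rw [Function.iterate_succ_apply'] at hx₁
      rw [add_zero, Function.iterate_succ_apply', h1 m (by omega)]
      simp [kwapiszMap, shearX, shearY, hx₁, slide_param_add_intCast hb]
    | succ i ih =>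
      intro hi
      rw [← add_assoc, Function.iterate_succ_apply', ih (by omega)]
      simp only [kwapiszMap, shearX, shearY, slide_of_eq_zero (h' (i + 1) (by omega) hi),
        slide_param_add_intCast hb]
      rw [← Function.iterate_succ_apply' (slide f b x₁)]
  have h4 := h3 (N - 1) (by omega)
  rwa [Nat.sub_add_cancel hN, ← Nat.add_sub_assoc hN] at h4

/-- The point `(x, y)` of the square `[0, Z]²`, translated by `D`, is the image of a point of the
square after `T` steps. -/
def Reached (f b : ℝ → ℝ) (Z : ℝ) (q : ℕ × ℤ × ℤ) (x y : ℝ) : Prop :=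
  (0 ≤ x ∧ x ≤ Z) ∧ (0 ≤ y ∧ y ≤ Z) ∧ ∃ x₀ y₀, (0 ≤ x₀ ∧ x₀ ≤ Z) ∧ (0 ≤ y₀ ∧ y₀ ≤ Z) ∧
    (kwapiszMap f b)^[q.1] (x₀, y₀) = (x + q.2.1, y + q.2.2)

/-- The duration and displacement of a trip with `M` horizontal and `N` vertical steps. -/
noncomputable def tripData (ρ : ℝ) (M N : ℕ) : ℕ × ℤ × ℤ := (M + N - 1, ⌊M * ρ⌋, ⌊N * ρ⌋)

lemma Reached.trip (hf : IsDenjoy ρ f p ℓ) (h0 : 0 < ρ) (hb : IsBump ℓ b Z) {M N : ℕ} (hM : 1 ≤ M)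
    (hN : 1 ≤ N) (hM' : ∀ i : ℕ, 0 < i → i < M → Int.fract (M * ρ) < Int.fract (i * ρ))
    (hN' : ∀ i : ℕ, 0 < i → i < N → Int.fract (N * ρ) < Int.fract (i * ρ)) {q : ℕ × ℤ × ℤ}
    {x y x₁ y₁ : ℝ} (h : Reached f b Z q x y) (hx : (slide f b y)^[M] x - ⌊M * ρ⌋ = x₁)
    (hy : (slide f b x₁)^[N] y - ⌊N * ρ⌋ = y₁) (hx₁ : 0 ≤ x₁ ∧ x₁ ≤ Z) (hy₁ : 0 ≤ y₁ ∧ y₁ ≤ Z) :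
    Reached f b Z (q + tripData ρ M N) x₁ y₁ := by
  obtain ⟨⟨h1, h2⟩, ⟨h3, h4⟩, x₀, y₀, h5, h6, h7⟩ := h
  have hlt := hb.lt
  refine ⟨hx₁, hy₁, x₀, y₀, h5, h6, ?_⟩
  have h8 : (q + tripData ρ M N).1 = M + N - 1 + q.1 := add_comm _ _
  rw [h8, Function.iterate_add_apply, h7, kwapiszMap_iterate_add hf hb,
    kwapiszMap_iterate_trip hb hM (x₁ := x₁) (j := ⌊M * ρ⌋) (by linarith)
      (fun i hi hiM => bump_iterate_eq_zero hf h0 hb hM' h1 (by linarith) (by linarith) hi hiM)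
      (fun i hi hiN => bump_iterate_eq_zero hf h0 hb hN' h3 (by linarith) (by linarith) hi hiN) hN,
    show (slide f b x₁)^[N] y = y₁ + ⌊N * ρ⌋ by linarith]
  ext <;> simp [tripData] <;> ring

/-- Some curve in the square crossing it vertically consists of reached points. -/
def CurveReached (f b : ℝ → ℝ) (Z : ℝ) (q : ℕ × ℤ × ℤ) : Prop :=
  ∃ r s : ℝ, r ≤ s ∧ ∃ u v : ℝ → ℝ, Continuous u ∧ Continuous v ∧ v r = 0 ∧ v s = Z ∧
    ∀ t, r ≤ t → t ≤ s → Reached f b Z q (u t) (v t)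

lemma continuous_slide_iterate (hf : IsDenjoy ρ f p ℓ) (hb : IsBump ℓ b Z) (n : ℕ) {u v : ℝ → ℝ}
    (hu : Continuous u) (hv : Continuous v) : Continuous fun t => (slide f b (v t))^[n] (u t) := by
  induction n with
  | zero => simpa
  | succ n ih =>
    simp only [Function.iterate_succ_apply']
    exact (continuous_slide hf hb).comp (ih.prodMk hv)

lemma slide_iterate_of_eq_zero {y : ℝ} (h : b y = 0) (n : ℕ) (x : ℝ) :
    (slide f b y)^[n] x = x := by
  rw [show slide f b y = id from funext (slide_of_eq_zero h), Function.iterate_id, id]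

lemma slide_iterate_of_eq_one {y : ℝ} (h : b y = 1) (n : ℕ) (x : ℝ) :
    (slide f b y)^[n] x = f^[n] x := by
  rw [show slide f b y = f from funext (slide_of_eq_one h)]

lemma lt_iterate_sub_floor (hirr : Irrational ρ) (hf : IsDenjoy ρ f p ℓ) {n : ℕ} (hn : 1 ≤ n)
    {x : ℝ} (hx : 0 ≤ x) (hx' : x ≤ ℓ) : ℓ < f^[n] x - ⌊n * ρ⌋ := by
  by_contra! h
  have h1 := hf.mono (sub_le_iff_le_add.1 h)
  rw [hf.semi_add_intCast, hf.semi_iterate, hf.semi_gap _ hx hx', hf.semi_gap _ hf.pos.le le_rfl]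
    at h1
  have h2 : (n : ℝ) * ρ = ⌊n * ρ⌋ := le_antisymm (by linarith) (Int.floor_le _)
  exact (Int.not_irrational _) (h2 ▸ hirr.natCast_mul (by omega))

lemma IsRecord.one_le_floor {M : ℕ} (hM : IsRecord ρ M) (h0 : 0 < ρ) : 1 ≤ ⌊M * ρ⌋ := by
  have h1 := hM.2 1 one_pos hM.1
  have h2 : (0 : ℝ) ≤ ⌊((1 : ℕ) : ℝ) * ρ⌋ := by
    exact_mod_cast Int.floor_nonneg.2 (by simpa using h0.le)
  have h3 : (0 : ℝ) < ⌊M * ρ⌋ := by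
    have h4 : (1 : ℝ) ≤ M := by exact_mod_cast hM.1.le
    rw [Int.fract, Int.fract] at h1
    push_cast at h1 h2
    nlinarith
  exact_mod_cast h3

lemma CurveReached.trip (hirr : Irrational ρ) (hf : IsDenjoy ρ f p ℓ) (h0 : 0 < ρ)
    (hb : IsBump ℓ b Z) {M N : ℕ} (hM : IsRecord ρ M) (hN : IsRecord ρ N) {q : ℕ × ℤ × ℤ}
    (h : CurveReached f b Z q) : CurveReached f b Z (q + tripData ρ M N) := by
  obtain ⟨r, s, hrs, u, v, hu, hv, hr, hs, h⟩ := h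
  have hlt := hb.lt
  have hlt1 := hf.lt_one
  have hjM : (1 : ℝ) ≤ ⌊M * ρ⌋ := by exact_mod_cast hM.one_le_floor h0
  have hjN : (1 : ℝ) ≤ ⌊N * ρ⌋ := by exact_mod_cast hN.one_le_floor h0
  have hg : Continuous fun t => (slide f b (v t))^[M] (u t) - ⌊M * ρ⌋ :=
    (continuous_slide_iterate hf hb M hu hv).sub continuous_const
  obtain ⟨t, t', h1, h2, h3, h4, h5, h6⟩ := exists_crossing hg hrs (c := 0) (d := Z) (by
    rw [hr, slide_iterate_of_eq_zero hb.zero]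
    linarith [(h r le_rfl hrs).1.2]) hb.pos.le (by
    rw [hs, slide_iterate_of_eq_one hb.top]
    have h7 := (h s hrs le_rfl).1
    linarith [lt_iterate_sub_floor hirr hf hM.1.le h7.1 (h7.2.trans hlt.le)])
  set g := fun t => (slide f b (v t))^[M] (u t) - ⌊M * ρ⌋
  have hk : Continuous fun t => (slide f b (g t))^[N] (v t) - ⌊N * ρ⌋ :=
    (continuous_slide_iterate hf hb N hv hg).sub continuous_const
  obtain ⟨w, w', k1, k2, k3, k4, k5, k6⟩ := exists_crossing hk h2 (c := 0) (d := Z) (by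
    rw [show g t = 0 from h4, slide_iterate_of_eq_zero hb.zero]
    linarith [(h t h1 (h2.trans h3)).2.1.2]) hb.pos.le (by
    rw [show g t' = Z from h5, slide_iterate_of_eq_one hb.top]
    have h7 := (h t' (h1.trans h2) h3).2.1
    linarith [lt_iterate_sub_floor hirr hf hN.1.le h7.1 (h7.2.trans hlt.le)])
  refine ⟨w, w', k2, g, _, hg, hk, k4, k5, fun e he he' => ?_⟩
  exact (h e (h1.trans (k1.trans he)) (he'.trans (k3.trans h3))).trip hf h0 hb hM.1.le hN.1.le hM.2
    hN.2 rfl rfl (h6 e (k1.trans he) (he'.trans k3)) (k6 e he he')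

lemma curveReached_nsmul_wait (hirr : Irrational ρ) (hf : IsDenjoy ρ f p ℓ) (h0 : 0 < ρ)
    (h1 : ρ < 1) (hb : IsBump ℓ b Z) (n : ℕ) :
    CurveReached f b Z (n • ((1, 0) : ℕ × ℤ × ℤ)) := by
  have hlt := hb.lt
  suffices H : ∃ r s : ℝ, r ≤ s ∧ ∃ u v : ℝ → ℝ, Continuous u ∧ Continuous v ∧ u r = 0 ∧ v r = 0 ∧
      v s = Z ∧ ∀ t, r ≤ t → t ≤ s → Reached f b Z (n • ((1, 0) : ℕ × ℤ × ℤ)) (u t) (v t) by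
    obtain ⟨r, s, hrs, u, v, hu, hv, -, h⟩ := H
    exact ⟨r, s, hrs, u, v, hu, hv, h⟩
  have htrip : tripData ρ 1 1 = (1, 0) := by
    have : ⌊ρ⌋ = 0 := Int.floor_eq_zero_iff.2 ⟨h0.le, h1⟩
    simp [tripData, this]
  have hfl : ∀ x, 0 ≤ x → x ≤ Z → Z ≤ f x := fun x hx hx' => by
    have h2 := lt_iterate_sub_floor hirr hf le_rfl hx (hx'.trans hlt.le)
    have h3 : ⌊((1 : ℕ) : ℝ) * ρ⌋ = 0 := Int.floor_eq_zero_iff.2 ⟨by simpa using h0.le, by simpa⟩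
    rw [h3, Function.iterate_one] at h2
    push_cast at h2
    linarith
  induction n with
  | zero =>
    refine ⟨0, Z, hb.pos.le, fun _ => 0, id, continuous_const, continuous_id, rfl, rfl, rfl,
      fun t ht ht' => ?_⟩
    exact ⟨⟨le_rfl, hb.pos.le⟩, ⟨ht, ht'⟩, 0, t, ⟨le_rfl, hb.pos.le⟩, ⟨ht, ht'⟩, by simp⟩
  | succ n ih =>
    obtain ⟨r, s, hrs, u, v, hu, hv, hur, hr, hs, h⟩ := ih
    have hg : Continuous fun t => slide f b (v t) (u t) :=
      continuous_slide_iterate hf hb 1 hu hv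
    have hpos : ∀ t, r ≤ t → t ≤ s → 0 ≤ slide f b (v t) (u t) := fun t ht ht' =>
      (h t ht ht').1.1.trans (le_slide hf h0 hb _ _)
    obtain ⟨t, k1, k2, k3, k4⟩ := exists_first_hit hg hrs (c := Z) (by
      rw [hr, slide_of_eq_zero hb.zero, hur]; exact hb.pos.le) (by
      rw [hs, slide_of_eq_one hb.top]
      exact hfl _ (h s hrs le_rfl).1.1 (h s hrs le_rfl).1.2)
    have hk : Continuous fun t => slide f b (slide f b (v t) (u t)) (v t) :=
      continuous_slide_iterate hf hb 1 hv hg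
    have hgr : slide f b (v r) (u r) = 0 := by rw [hr, slide_of_eq_zero hb.zero, hur]
    obtain ⟨t', m1, m2, m3, m4⟩ := exists_first_hit hk k1 (c := Z) (by
      rw [hgr, slide_of_eq_zero hb.zero, hr]; exact hb.pos.le) (by
      rw [k3, slide_of_eq_one hb.top]
      exact hfl _ (h t k1 k2).2.1.1 (h t k1 k2).2.1.2)
    refine ⟨r, t', m1, _, _, hg, hk, hgr, by rw [hgr, slide_of_eq_zero hb.zero, hr], m3,
      fun e he he' => ?_⟩
    have h6 := h e he (he'.trans (m2.trans k2))
    have h7 := h6.trip hf h0 hb le_rfl le_rfl (by omega) (by omega)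
      (x₁ := slide f b (v e) (u e)) (y₁ := slide f b (slide f b (v e) (u e)) (v e))
      (by simp [Int.floor_eq_zero_iff.2 ⟨h0.le, h1⟩])
      (by simp [Int.floor_eq_zero_iff.2 ⟨h0.le, h1⟩])
      ⟨hpos e he (he'.trans (m2.trans k2)), k4 e he (he'.trans m2)⟩
      ⟨h6.2.1.1.trans (le_slide hf h0 hb _ _), m4 e he he'⟩
    rwa [htrip, ← succ_nsmul] at h7

/-- The durations and displacements of concatenations of waiting times and trips. -/
noncomputable def tripMonoid (ρ : ℝ) : AddSubmonoid (ℕ × ℤ × ℤ) :=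
  AddSubmonoid.closure ({(1, 0)} ∪ {q | ∃ M N, IsRecord ρ M ∧ IsRecord ρ N ∧ q = tripData ρ M N})

lemma curveReached_of_mem (hirr : Irrational ρ) (hf : IsDenjoy ρ f p ℓ) (h0 : 0 < ρ)
    (h1 : ρ < 1) (hb : IsBump ℓ b Z) {q : ℕ × ℤ × ℤ} (hq : q ∈ tripMonoid ρ) :
    CurveReached f b Z q := by
  rw [tripMonoid, AddSubmonoid.closure_union, AddSubmonoid.mem_sup] at hq
  obtain ⟨w, hw, c, hc, rfl⟩ := hq
  obtain ⟨n, rfl⟩ := AddSubmonoid.mem_closure_singleton.1 hw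
  have H : ∀ q, CurveReached f b Z q → CurveReached f b Z (q + c) := by
    induction hc using AddSubmonoid.closure_induction with
    | mem x hx =>
      obtain ⟨M, N, hM, hN, rfl⟩ := hx
      exact fun q hq => hq.trip hirr hf h0 hb hM hN
    | zero => simp
    | add x y _ _ ihx ihy => exact fun q hq => by rw [← add_assoc]; exact ihy _ (ihx _ hq)
  exact H _ (curveReached_nsmul_wait hirr hf h0 h1 hb n)

/-- The average velocity of a trip. -/
noncomputable def velocity (q : ℕ × ℤ × ℤ) : ℝ × ℝ := (q.1 : ℝ)⁻¹ • ((q.2.1 : ℝ), (q.2.2 : ℝ))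

lemma velocity_mem_rotSet (hirr : Irrational ρ) (hf : IsDenjoy ρ f p ℓ) (h0 : 0 < ρ)
    (h1 : ρ < 1) (hb : IsBump ℓ b Z) {q : ℕ × ℤ × ℤ} (hq : q ∈ tripMonoid ρ) (hq0 : 0 < q.1) :
    velocity q ∈ rotSet (kwapiszMap f b) := by
  refine Set.mem_iInter.2 fun m => Metric.mem_closure_iff.2 fun ε hε => ?_
  obtain ⟨k, hk⟩ := exists_nat_gt (1 / ε)
  set n := max (m + 1) k with hn
  obtain ⟨r, s, hrs, u, v, -, -, -, -, h⟩ :=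
    curveReached_of_mem hirr hf h0 h1 hb (nsmul_mem hq n)
  obtain ⟨⟨h2, h3⟩, ⟨h4, h5⟩, x₀, y₀, ⟨h6, h7⟩, ⟨h8, h9⟩, h10⟩ := h r le_rfl hrs
  have hnm : m < n := by omega
  have hnk : k ≤ n := le_max_right _ _
  have hnq : n ≤ n * q.1 := Nat.le_mul_of_pos_right n hq0
  refine ⟨_, Set.mem_iUnion₂.2 ⟨n * q.1, Set.mem_Ioi.2 (by omega), (x₀, y₀), rfl⟩, ?_⟩
  have hn0 : (0 : ℝ) < n := by exact_mod_cast (by omega : 0 < n)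
  have hq0' : (0 : ℝ) < q.1 := by exact_mod_cast hq0
  have h11 : (kwapiszMap f b)^[n * q.1] (x₀, y₀) = (u r + n * q.2.1, v r + n * q.2.2) := by
    simpa using h10
  have hZ : Z < 1 := hb.lt.trans hf.lt_one
  rw [dist_comm, dist_eq_norm, h11]
  have h12 : (((n * q.1 : ℕ) : ℝ))⁻¹ • ((u r + n * q.2.1, v r + n * q.2.2) - (x₀, y₀)) - velocity q
      = (((n * q.1 : ℕ) : ℝ))⁻¹ • ((u r - x₀, v r - y₀) : ℝ × ℝ) := by
    rw [velocity]
    ext <;> simp <;> field_simp <;> ring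
  rw [h12, norm_smul]
  have h13 : ‖((u r - x₀, v r - y₀) : ℝ × ℝ)‖ ≤ 1 := by
    refine norm_prod_le_iff.2 ⟨?_, ?_⟩ <;> rw [Real.norm_eq_abs, abs_le] <;> constructor <;>
      simp only <;> linarith
  have h14 : (k : ℝ) ≤ (n * q.1 : ℕ) := by exact_mod_cast hnk.trans hnq
  rw [Real.norm_of_nonneg (by positivity)]
  calc (((n * q.1 : ℕ) : ℝ))⁻¹ * ‖((u r - x₀, v r - y₀) : ℝ × ℝ)‖
      ≤ (((n * q.1 : ℕ) : ℝ))⁻¹ * 1 := by gcongr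
    _ < ε := by
      rw [mul_one]
      have h15 : 1 / ε < (n * q.1 : ℕ) := hk.trans_le h14
      rw [one_div] at h15
      exact inv_lt_of_inv_lt₀ hε h15

end Realize

/-! ### Lower bound for the rotation set -/

section Records

variable {ρ : ℝ}

lemma fract_natCast_mul_pos (hirr : Irrational ρ) {n : ℕ} (hn : 0 < n) :
    0 < Int.fract (n * ρ) := by
  refine (Int.fract_nonneg _).lt_of_ne fun h => ?_
  have h2 : (n : ℝ) * ρ = ⌊n * ρ⌋ := by rw [Int.fract] at h; linarith
  exact (Int.not_irrational _) (h2 ▸ hirr.natCast_mul hn.ne')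

lemma exists_fract_lt (hirr : Irrational ρ) {δ : ℝ} (hδ : 0 < δ) :
    ∃ M : ℕ, 0 < M ∧ Int.fract (M * ρ) < δ := by
  obtain ⟨n, hn⟩ := exists_nat_gt (1 / δ)
  have hn0 : (0 : ℝ) < n := (by positivity : 0 < 1 / δ).trans hn
  obtain ⟨k, hk, -, hkr⟩ := Real.exists_nat_abs_mul_sub_round_le ρ (n := n) (by exact_mod_cast hn0)
  have h1 : |(k : ℝ) * ρ - round (k * ρ)| < δ := by
    refine hkr.trans_lt ?_
    rw [div_lt_iff₀ hδ] at hn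
    rw [div_lt_iff₀ (by positivity)]
    nlinarith
  set r := round ((k : ℝ) * ρ)
  rw [abs_lt] at h1
  rcases le_total 0 ((k : ℝ) * ρ - r) with h2 | h2
  · refine ⟨k, hk, lt_of_le_of_lt ?_ h1.2⟩
    have : r ≤ ⌊(k : ℝ) * ρ⌋ := Int.le_floor.2 (by linarith)
    have : (r : ℝ) ≤ ⌊(k : ℝ) * ρ⌋ := by exact_mod_cast this
    rw [Int.fract]; linarith
  · have h3 : 0 < (r : ℝ) - k * ρ := by
      refine lt_of_le_of_ne (by linarith) fun h => ?_
      have h4 : (k : ℝ) * ρ = r := by linarith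
      exact (Int.not_irrational r) (h4 ▸ hirr.natCast_mul hk.ne')
    set η := (r : ℝ) - k * ρ with hη
    have h5 : (⌊1 / η⌋₊ : ℝ) ≤ 1 / η := Nat.floor_le (by positivity)
    have h6 : 1 / η < ⌊1 / η⌋₊ + 1 := Nat.lt_floor_add_one _
    rw [le_div_iff₀ h3] at h5
    rw [div_lt_iff₀ h3] at h6
    rcases lt_or_ge δ 1 with hδ1 | hδ1
    · have h7 : 0 < ⌊1 / η⌋₊ := by
        rw [Nat.floor_pos, le_div_iff₀ h3]; linarith
      refine ⟨⌊1 / η⌋₊ * k, by positivity, ?_⟩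
      have h8 : (⌊1 / η⌋₊ : ℤ) * r - 1 ≤ ⌊((⌊1 / η⌋₊ * k : ℕ) : ℝ) * ρ⌋ := by
        rw [Int.le_floor]
        push_cast
        have : (⌊1 / η⌋₊ : ℝ) * η = ⌊1 / η⌋₊ * r - ⌊1 / η⌋₊ * k * ρ := by rw [hη]; ring
        linarith
      have h9 : (⌊1 / η⌋₊ : ℝ) * r - 1 ≤ ⌊((⌊1 / η⌋₊ * k : ℕ) : ℝ) * ρ⌋ := by exact_mod_cast h8
      rw [Int.fract]
      push_cast at h9 ⊢
      have : (⌊1 / η⌋₊ : ℝ) * η = ⌊1 / η⌋₊ * r - ⌊1 / η⌋₊ * k * ρ := by rw [hη]; ring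
      linarith
    · exact ⟨1, one_pos, (Int.fract_lt_one _).trans_le hδ1⟩

lemma exists_isRecord_gt (hirr : Irrational ρ) (K : ℕ) : ∃ M, K < M ∧ IsRecord ρ M := by
  obtain ⟨i₀, hi₀, hmin⟩ := Finset.exists_min_image (Finset.Icc 1 (K + 1))
    (fun i : ℕ => Int.fract (i * ρ)) ⟨1, by simp⟩
  rw [Finset.mem_Icc] at hi₀
  have hex := exists_fract_lt hirr (fract_natCast_mul_pos hirr (n := i₀) (by omega))
  classical
  obtain ⟨h1, h2⟩ := Nat.find_spec hex
  have h3 : K + 1 < Nat.find hex := by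
    by_contra! h
    exact (hmin _ (Finset.mem_Icc.2 ⟨h1, h⟩)).not_gt h2
  refine ⟨Nat.find hex, by omega, by omega, fun i hi hiM => ?_⟩
  by_contra! h
  exact Nat.find_min hex hiM ⟨hi, h.trans_lt h2⟩

/-- The average velocity of a trip with `M` horizontal and `N` vertical steps. -/
noncomputable def tripVelocity (ρ : ℝ) (M N : ℕ) : ℝ × ℝ :=
  ((⌊M * ρ⌋ : ℝ) / ((M : ℝ) + N - 1), (⌊N * ρ⌋ : ℝ) / ((M : ℝ) + N - 1))

lemma swap_tripVelocity (ρ : ℝ) (M N : ℕ) : (tripVelocity ρ M N).swap = tripVelocity ρ N M := by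
  simp [tripVelocity, add_comm]

lemma rho_zero_mem (hirr : Irrational ρ) (h0 : 0 < ρ) {E : Set (ℝ × ℝ)} (hE : IsClosed E)
    (h : ∀ M N, IsRecord ρ M → IsRecord ρ N → tripVelocity ρ M N ∈ E) : (ρ, 0) ∈ E := by
  obtain ⟨N, -, hN⟩ := exists_isRecord_gt hirr 0
  choose M hM hM' using exists_isRecord_gt hirr
  have hlim : Tendsto (fun x : ℝ => x + N - 1) atTop atTop := by
    simp only [add_sub_assoc]
    exact tendsto_atTop_add_const_right _ _ tendsto_id
  have hfst : Tendsto (fun x : ℝ => (⌊x * ρ⌋ : ℝ) / (x + N - 1)) atTop (𝓝 ρ) := by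
    have h1 : Tendsto (fun x : ℝ => (⌊ρ * x⌋₊ : ℝ) / x) atTop (𝓝 ρ) :=
      tendsto_nat_floor_mul_div_atTop h0.le
    have h2 : Tendsto (fun x : ℝ => 1 - ((N : ℝ) - 1) / (x + N - 1)) atTop (𝓝 (1 - 0)) :=
      tendsto_const_nhds.sub (hlim.const_div_atTop _)
    have h3 := h1.mul h2
    rw [sub_zero, mul_one] at h3
    refine h3.congr' ?_
    filter_upwards [eventually_gt_atTop 0, hlim.eventually_gt_atTop 0] with x hx hx'
    rw [natCast_floor_eq_intCast_floor (by positivity), mul_comm ρ x]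
    field_simp
    ring
  have hsnd : Tendsto (fun x : ℝ => (⌊N * ρ⌋ : ℝ) / (x + N - 1)) atTop (𝓝 0) :=
    hlim.const_div_atTop _
  have hMlim : Tendsto (fun n => (M n : ℝ)) atTop atTop :=
    tendsto_natCast_atTop_atTop.comp (tendsto_atTop_mono (fun n => (hM n).le) tendsto_id)
  exact hE.mem_of_tendsto ((hfst.prodMk_nhds hsnd).comp hMlim)
    (Eventually.of_forall fun n => h _ _ (hM' n) hN)

lemma floor_div_le (h0 : 0 < ρ) (n : ℕ) : 0 ≤ (⌊n * ρ⌋ : ℝ) / n ∧ (⌊n * ρ⌋ : ℝ) / n ≤ ρ := by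
  have h1 : (0 : ℝ) ≤ ⌊n * ρ⌋ := by exact_mod_cast Int.floor_nonneg.2 (by positivity)
  refine ⟨by positivity, ?_⟩
  rcases Nat.eq_zero_or_pos n with rfl | hn
  · simpa using h0.le
  · rw [div_le_iff₀ (by positivity), mul_comm]
    exact Int.floor_le _

lemma tripVelocity_mem_of_isRecord (h0 : 0 < ρ) (h1 : ρ < 1) {E : Set (ℝ × ℝ)}
    (hE : Convex ℝ E) (hE0 : 0 ∈ E) (hx : (ρ, 0) ∈ E) (hy : (0, ρ) ∈ E) {N : ℕ} (hN : 1 ≤ N)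
    (h : ∀ M, IsRecord ρ M → tripVelocity ρ M N ∈ E) {M : ℕ} (hM : 1 ≤ M) :
    tripVelocity ρ M N ∈ E := by
  have hax : ∀ v ∈ E, ∀ t, 0 ≤ t → t ≤ ρ → (t / ρ) • v ∈ E := fun v hv t ht ht' =>
    hE.smul_mem_of_zero_mem hE0 hv ⟨by positivity, (div_le_one h0).2 ht'⟩
  induction M using Nat.strong_induction_on with
  | _ M ih =>
    rcases hM.eq_or_lt with rfl | hM1
    · have h2 := hax _ hy _ (floor_div_le h0 N).1 (floor_div_le h0 N).2
      have h3 : ⌊ρ⌋ = 0 := Int.floor_eq_zero_iff.2 ⟨h0.le, h1⟩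
      convert h2 using 1
      ext <;> simp [tripVelocity, h3]
      field_simp
    by_cases hrec : IsRecord ρ M
    · exact h M hrec
    obtain ⟨i, hi, hiM, hfr⟩ : ∃ i : ℕ, 0 < i ∧ i < M ∧ Int.fract (i * ρ) ≤ Int.fract (M * ρ) := by
      simpa [IsRecord, hM1] using hrec
    have h2 := hax _ hx _ (floor_div_le h0 i).1 (floor_div_le h0 i).2
    have h3 := ih (M - i) (by omega) (by omega)
    have hfl : ⌊((M - i : ℕ) : ℝ) * ρ⌋ = ⌊M * ρ⌋ - ⌊i * ρ⌋ := by
      rw [Int.floor_eq_iff, Nat.cast_sub hiM.le]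
      have h4 := Int.fract_lt_one ((M : ℝ) * ρ)
      have h5 := Int.fract_nonneg ((i : ℝ) * ρ)
      rw [Int.fract] at hfr h4 h5
      rw [Int.fract] at hfr
      push_cast
      constructor <;> linarith
    have hi0 : (0 : ℝ) < i := by exact_mod_cast hi
    have hiM' : (i : ℝ) < M := by exact_mod_cast hiM
    have hN' : (1 : ℝ) ≤ N := by exact_mod_cast hN
    have hd : (0 : ℝ) < (M : ℝ) + N - 1 := by linarith
    have hd' : (0 : ℝ) < (M : ℝ) - i + N - 1 := by linarith
    have h4 := hE h2 h3 (a := i / ((M : ℝ) + N - 1)) (b := ((M : ℝ) - i + N - 1) / (M + N - 1))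
      (by positivity) (by positivity) (by field_simp; ring)
    convert h4 using 1
    rw [tripVelocity, tripVelocity, hfl, Nat.cast_sub hiM.le]
    ext
    · simp
      field_simp
      ring
    · simp
      field_simp

lemma lambdaSet_subset (hirr : Irrational ρ) (h0 : 0 < ρ) (h1 : ρ < 1) {E : Set (ℝ × ℝ)}
    (hE : Convex ℝ E) (hc : IsClosed E) (hE0 : 0 ∈ E)
    (h : ∀ M N, IsRecord ρ M → IsRecord ρ N → tripVelocity ρ M N ∈ E) : LambdaSet ρ ⊆ E := by
  have hx := rho_zero_mem hirr h0 hc h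
  have hS : Convex ℝ (Prod.swap ⁻¹' E) :=
    hE.linear_preimage (LinearEquiv.prodComm ℝ ℝ ℝ).toLinearMap
  have hS' : ∀ M N, IsRecord ρ M → IsRecord ρ N → tripVelocity ρ M N ∈ Prod.swap ⁻¹' E :=
    fun M N hM hN => by
      rw [Set.mem_preimage, swap_tripVelocity]
      exact h N M hN hM
  have hy : (0, ρ) ∈ E := rho_zero_mem hirr h0 (hc.preimage continuous_swap) hS'
  have hall : ∀ M N, 1 ≤ M → 1 ≤ N → tripVelocity ρ M N ∈ E := by
    intro M N hM hN
    refine tripVelocity_mem_of_isRecord h0 h1 hE hE0 hx hy hN (fun M' hM' => ?_) hM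
    have h2 := tripVelocity_mem_of_isRecord h0 h1 hS hE0 hy hx hM'.1.le
      (fun N' hN' => hS' N' M' hN' hM') hN
    rwa [Set.mem_preimage, swap_tripVelocity] at h2
  refine closure_minimal (convexHull_min (Set.union_subset (Set.singleton_subset_iff.2 hE0) ?_) hE)
    hc
  rintro _ ⟨m, n, hm, hn, rfl⟩
  have hceil : ∀ m : ℕ, alphaSeq ρ m < ρ → ⌊((m + 1 : ℕ) : ℝ) * ρ⌋ = ⌈(m : ℝ) * ρ⌉ := fun m hm => by
    rw [alphaSeq] at hm
    rw [Int.floor_eq_iff]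
    push_cast
    constructor <;> linarith [Int.le_ceil ((m : ℝ) * ρ)]
  have h2 := hall (m + 1) (n + 1) (by omega) (by omega)
  rw [tripVelocity, hceil m hm, hceil n hn] at h2
  convert h2 using 1
  have h3 : ((m + 1 : ℕ) : ℝ) + (n + 1 : ℕ) - 1 = m + n + 1 := by push_cast; ring
  rw [h3, vecRho]

lemma convex_closure_velocity (A : AddSubmonoid (ℕ × ℤ × ℤ)) :
    Convex ℝ (closure {w | ∃ q ∈ A, 0 < q.1 ∧ w = velocity q}) := by
  have key : ∀ a : ℝ, 0 ≤ a → a ≤ 1 → ∀ w ∈ {w | ∃ q ∈ A, 0 < q.1 ∧ w = velocity q},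
      ∀ w' ∈ {w | ∃ q ∈ A, 0 < q.1 ∧ w = velocity q},
      a • w + (1 - a) • w' ∈ closure {w | ∃ q ∈ A, 0 < q.1 ∧ w = velocity q} := by
    rintro a ha ha' _ ⟨q, hq, hq0, rfl⟩ _ ⟨q', hq', hq0', rfl⟩
    have h1 : Tendsto (fun n : ℕ => (⌊a * (n : ℝ)⌋₊ : ℝ) / (n : ℝ)) atTop (𝓝 a) :=
      (tendsto_nat_floor_mul_div_atTop ha).comp tendsto_natCast_atTop_atTop
    have h2 := (h1.smul_const (velocity q)).add ((h1.const_sub 1).smul_const (velocity q'))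
    refine mem_closure_of_tendsto h2 ?_
    filter_upwards [eventually_gt_atTop 0] with n hn
    have h3 : ⌊a * (n : ℝ)⌋₊ ≤ n := Nat.floor_le_of_le (mul_le_of_le_one_left (by positivity) ha')
    set m := ⌊a * (n : ℝ)⌋₊
    refine ⟨m • q'.1 • q + (n - m) • q.1 • q',
      add_mem (nsmul_mem (nsmul_mem hq _) _) (nsmul_mem (nsmul_mem hq' _) _), ?_, ?_⟩
    · have h4 : m * (q'.1 * q.1) + (n - m) * (q.1 * q'.1) = n * (q.1 * q'.1) := by
        rw [mul_comm q'.1, ← add_mul, Nat.add_sub_cancel' h3]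
      simp only [Prod.fst_add, Prod.smul_fst, smul_eq_mul, h4]
      positivity
    · have hn' : (0 : ℝ) < n := by exact_mod_cast hn
      have e1 : (0 : ℝ) < q.1 := by exact_mod_cast hq0
      have e2 : (0 : ℝ) < q'.1 := by exact_mod_cast hq0'
      have h4 : (m : ℝ) * (q'.1 * q.1) + (n - m) * (q.1 * q'.1) = n * (q.1 * q'.1) := by ring
      ext <;> simp [velocity, Nat.cast_sub h3, h4] <;> field_simp
  intro w hw w' hw' a c ha hc hac
  obtain rfl : c = 1 - a := by linarith
  have h1 := map_mem_closure₂ (f := fun w w' : ℝ × ℝ => a • w + (1 - a) • w') (by fun_prop) hw hw'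
    (key a ha (by linarith))
  rwa [closure_closure] at h1

lemma isClosed_rotSet (F : ℝ × ℝ → ℝ × ℝ) : IsClosed (rotSet F) :=
  isClosed_iInter fun _ => isClosed_closure

theorem lambdaSet_subset_rotSet {ℓ Z : ℝ} {f p b : ℝ → ℝ} (hirr : Irrational ρ) (h0 : 0 < ρ)
    (h1 : ρ < 1) (hf : IsDenjoy ρ f p ℓ) (hb : IsBump ℓ b Z) :
    LambdaSet ρ ⊆ rotSet (kwapiszMap f b) := by
  have h2 : closure {w | ∃ q ∈ tripMonoid ρ, 0 < q.1 ∧ w = velocity q} ⊆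
      rotSet (kwapiszMap f b) := by
    refine closure_minimal ?_ (isClosed_rotSet _)
    rintro _ ⟨q, hq, hq0, rfl⟩
    exact velocity_mem_rotSet hirr hf h0 h1 hb hq hq0
  refine (lambdaSet_subset hirr h0 h1 (convex_closure_velocity _) isClosed_closure ?_ ?_).trans h2
  · exact subset_closure ⟨_, AddSubmonoid.subset_closure (Or.inl rfl), one_pos, by simp [velocity]; rfl⟩
  · intro M N hM hN
    have h3 : 0 < M + N - 1 := by have := hM.1; omega
    refine subset_closure ⟨_, AddSubmonoid.subset_closure (Or.inr ⟨M, N, hM, hN, rfl⟩), h3, ?_⟩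
    have h4 : ((M + N - 1 : ℕ) : ℝ) = M + N - 1 := by
      rw [Nat.cast_sub (by omega)]; push_cast; ring
    rw [velocity, tripVelocity, tripData]
    simp only [h4]
    ext <;> simp <;> ring

end Records

theorem stmt0 (ρ : ℝ) (hirr : Irrational ρ) (h0 : 0 < ρ) (h1 : ρ < 1) :
    ∃ G Ginv : ℝ × ℝ → ℝ × ℝ,
      ContDiff ℝ 1 G ∧ ContDiff ℝ 1 Ginv ∧
      Function.LeftInverse Ginv G ∧ Function.RightInverse Ginv G ∧
      (∀ (x : ℝ × ℝ) (v : ℤ × ℤ),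
        G (x + ((v.1 : ℝ), (v.2 : ℝ))) = G x + ((v.1 : ℝ), (v.2 : ℝ))) ∧
      rotSet G = LambdaSet ρ := by
  obtain ⟨f, p, ℓ, hf⟩ := exists_isDenjoy hirr
  obtain ⟨b, Z, hb⟩ := exists_isBump hf.pos hf.lt_one
  obtain ⟨g, hg, hl, hr⟩ := exists_kwapiszMap_inverse hf h0 hb
  exact ⟨kwapiszMap f b, g, contDiff_kwapiszMap hf hb, hg, hl, hr, kwapiszMap_add_intCast hf hb,
    (rotSet_subset hirr h0 h1 hf hb).antisymm (lambdaSet_subset_rotSet hirr h0 h1 hf hb)⟩
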